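/- arXiv:2202.04532 — 2 statements merged into one kernel-verified Lean document; each statement's English description precedes it below -/
import Mathlib

section
/- Let X ⊂ ℙ²(ℝ) be (the real locus of) a smooth real plane quartic curve whose real locus has at least 3 connected components, and let Ω₁, Ω₂ be two of them. Suppose p is a point of a third component. Then no line through p meets both Ω₁ and Ω₂ (intersection-count argument), and consequently there exists a line of ℙ²(ℝ) simultaneously supporting (tangent to) Ω₁ and Ω₂. -/
noncomputable instance instTopProjectivization (V : Type*) [AddCommGroup V] [Module ℝ V]
    [TopologicalSpace V] : TopologicalSpace (Projectivization ℝ V) :=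
  inferInstanceAs (TopologicalSpace (Quotient (projectivizationSetoid ℝ V)))

/-- Real projective n-space. -/
abbrev Proj (n : ℕ) := Projectivization ℝ (Fin (n + 1) → ℝ)

/-- The dual projective space, projectivizing (continuous) linear forms. -/
abbrev DProj (n : ℕ) := Projectivization ℝ ((Fin (n + 1) → ℝ) →L[ℝ] ℝ)

/-- The hyperplane `f supports A at x` in some affine chart: `x ∈ A ∩ H` and, in the affine
chart given by a form `g` (complement of `{g = 0}`) containing `x` and `A`, the set `A` lies in
one of the two closed half-spaces bounded by the hyperplane `{f = 0}`. -/
def SupportsAt {n : ℕ} (f : (Fin (n + 1) → ℝ) →L[ℝ] ℝ) (A : Set (Proj n)) (x : Proj n) : Prop :=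
  x ∈ A ∧ f x.rep = 0 ∧
    ∃ g : (Fin (n + 1) → ℝ) →L[ℝ] ℝ, g x.rep ≠ 0 ∧ (∀ y ∈ A, g y.rep ≠ 0) ∧
      ((∀ y ∈ A, 0 ≤ f y.rep * g y.rep) ∨ (∀ y ∈ A, f y.rep * g y.rep ≤ 0))



theorem qb_hom (Q : MvPolynomial (Fin 3) ℝ) (n : ℕ) (hQ : Q.IsHomogeneous n) (t : ℝ)
    (v : Fin 3 → ℝ) : MvPolynomial.eval (t • v) Q = t ^ n * MvPolynomial.eval v Q := by
  rw [MvPolynomial.eval_eq', MvPolynomial.eval_eq', Finset.mul_sum]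
  refine Finset.sum_congr rfl fun d hd => ?_
  have h : ∑ i, d i = n := by
    have := hQ (MvPolynomial.mem_support_iff.mp hd)
    rw [← this]
    simp [Finsupp.weight_apply, Finsupp.sum_fintype]
  simp only [Pi.smul_apply, smul_eq_mul, mul_pow, Finset.prod_mul_distrib]
  rw [Finset.prod_pow_eq_pow_sum, h]
  ring

theorem qb_coeffs (Q : MvPolynomial (Fin 3) ℝ) (hQ : Q.IsHomogeneous 4) (p : Fin 3 → ℝ) :
    ∃ c0 c1 c2 c3 : (Fin 3 → ℝ) → ℝ, Continuous c2 ∧ Continuous c3 ∧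
      ∀ (u : Fin 3 → ℝ) (s : ℝ), MvPolynomial.eval (s • p + u) Q =
        c0 u + c1 u * s + c2 u * s ^ 2 + c3 u * s ^ 3 + MvPolynomial.eval p Q * s ^ 4 := by
  classical
  let P : (Fin 3 → ℝ) → Polynomial ℝ := fun u =>
    MvPolynomial.aeval (fun i => Polynomial.C (u i) + Polynomial.C (p i) * Polynomial.X) Q
  have hdeg : ∀ u, (P u).natDegree ≤ 4 := by
    intro u
    have := MvPolynomial.aeval_natDegree_le (m := 4) (n := 1) Q hQ.totalDegree_le
      (fun i => Polynomial.C (u i) + Polynomial.C (p i) * Polynomial.X) (by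
        intro i
        compute_degree)
    simpa using this
  have hev : ∀ u s, (P u).eval s = MvPolynomial.eval (s • p + u) Q := by
    intro u s
    have h : (Polynomial.aeval s) (P u) = MvPolynomial.aeval (s • p + u) Q := by
      simp only [P]
      have := MvPolynomial.comp_aeval_apply
        (fun i => Polynomial.C (u i) + Polynomial.C (p i) * Polynomial.X) (Polynomial.aeval s) Q
      rw [this]
      have e : (fun i => (Polynomial.aeval s)
          (Polynomial.C (u i) + Polynomial.C (p i) * Polynomial.X)) = s • p + u := by
        funext i
        simp
        ring
      rw [e]
    simpa [MvPolynomial.aeval_eq_eval, Polynomial.coe_aeval_eq_eval] using h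
  have hcont : ∀ k, Continuous fun u => (P u).coeff k := by
    simp only [P]
    clear hdeg hev P hQ
    induction Q using MvPolynomial.induction_on with
    | C a => intro k; simpa using continuous_const
    | add f g hf hg => intro k; simp only [map_add, Polynomial.coeff_add]; exact (hf k).add (hg k)
    | mul_X f i hf =>
      intro k
      simp only [map_mul, MvPolynomial.aeval_X, mul_add, ← mul_assoc, Polynomial.coeff_add,
        Polynomial.coeff_mul_C]
      refine ((hf k).mul (continuous_apply i)).add ?_
      cases k with
      | zero => simpa using continuous_const
      | succ k =>
        simp only [Polynomial.coeff_mul_X, Polynomial.coeff_mul_C]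
        exact (hf k).mul continuous_const
  have hexp : ∀ u s, MvPolynomial.eval (s • p + u) Q = (P u).coeff 0 + (P u).coeff 1 * s
      + (P u).coeff 2 * s ^ 2 + (P u).coeff 3 * s ^ 3 + (P u).coeff 4 * s ^ 4 := by
    intro u s
    rw [← hev, Polynomial.eval_eq_sum_range' (n := 5) (by have := hdeg u; omega)]
    simp [Finset.sum_range_succ]
  have h4 : ∀ u, (P u).coeff 4 = MvPolynomial.eval p Q := by
    intro u
    have e : ∀ t : ℝ, t ≠ 0 → MvPolynomial.eval (p + t • u) Q = (P u).coeff 0 * t ^ 4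
      + (P u).coeff 1 * t ^ 3
      + (P u).coeff 2 * t ^ 2 + (P u).coeff 3 * t + (P u).coeff 4 := by
      intro t ht
      have h1 := hexp u t⁻¹
      have h3 : MvPolynomial.eval (t • (t⁻¹ • p + u)) Q
          = t ^ 4 * MvPolynomial.eval (t⁻¹ • p + u) Q := qb_hom Q 4 hQ _ _
      rw [smul_add, smul_smul, mul_inv_cancel₀ ht, one_smul, h1] at h3
      rw [h3]; field_simp
    have l1 : Filter.Tendsto (fun t : ℝ => MvPolynomial.eval (p + t • u) Q) (nhdsWithin 0 {0}ᶜ)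
        (nhds (MvPolynomial.eval (p + (0:ℝ) • u) Q)) := by
      refine Filter.Tendsto.mono_left (Continuous.tendsto ?_ 0) nhdsWithin_le_nhds
      exact (MvPolynomial.continuous_eval Q).comp (by fun_prop)
    have l2 : Filter.Tendsto (fun t : ℝ => (P u).coeff 0 * t ^ 4
      + (P u).coeff 1 * t ^ 3
      + (P u).coeff 2 * t ^ 2 + (P u).coeff 3 * t + (P u).coeff 4) (nhdsWithin 0 {0}ᶜ)
        (nhds ((P u).coeff 0 * 0 ^ 4
      + (P u).coeff 1 * 0 ^ 3
      + (P u).coeff 2 * 0 ^ 2 + (P u).coeff 3 * 0 + (P u).coeff 4)) := by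
      refine Filter.Tendsto.mono_left (Continuous.tendsto (f := fun t : ℝ => (P u).coeff 0 * t ^ 4
      + (P u).coeff 1 * t ^ 3
      + (P u).coeff 2 * t ^ 2 + (P u).coeff 3 * t + (P u).coeff 4) (by fun_prop) 0) nhdsWithin_le_nhds
    have l3 := l1.congr' (by
      filter_upwards [self_mem_nhdsWithin] with t ht
      exact e t ht)
    have := tendsto_nhds_unique l2 l3
    simpa using this
  refine ⟨fun u => (P u).coeff 0, fun u => (P u).coeff 1, fun u => (P u).coeff 2,
    fun u => (P u).coeff 3, hcont 2, hcont 3, ?_⟩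
  intro u s
  rw [hexp, h4]

theorem qb_deriv (Q : MvPolynomial (Fin 3) ℝ) (v w : Fin 3 → ℝ) :
    HasDerivAt (fun t : ℝ => MvPolynomial.eval (v + t • w) Q)
      (∑ i, w i * MvPolynomial.eval v (MvPolynomial.pderiv i Q)) 0 := by
  classical
  induction Q using MvPolynomial.induction_on with
  | C a => simpa using hasDerivAt_const (0:ℝ) a
  | add f g hf hg =>
    simp only [map_add, mul_add, Finset.sum_add_distrib]
    exact hf.add hg
  | mul_X f i hf =>
    have h := hf.mul (((hasDerivAt_id (0:ℝ)).mul_const (w i)).const_add (v i))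
    have e1 : (fun t : ℝ => MvPolynomial.eval (v + t • w) (f * MvPolynomial.X i)) =
        ((fun t => (MvPolynomial.eval (v + t • w)) f) * fun x => v i + id x * w i) := by
      funext t; simp
    have e2 : ∑ j, w j * (MvPolynomial.eval v) ((MvPolynomial.pderiv j) (f * MvPolynomial.X i)) =
        (∑ j, w j * (MvPolynomial.eval v) ((MvPolynomial.pderiv j) f)) * (v i + id 0 * w i) +
        (MvPolynomial.eval (v + (0:ℝ) • w)) f * (1 * w i) := by
      have : ∀ j, w j * (MvPolynomial.eval v) ((MvPolynomial.pderiv j) (f * MvPolynomial.X i)) =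
          w j * (MvPolynomial.eval v) ((MvPolynomial.pderiv j) f) * v i +
          (if j = i then w j * MvPolynomial.eval v f else 0) := by
        intro j
        rw [MvPolynomial.pderiv_mul, MvPolynomial.pderiv_X]
        by_cases hj : j = i
        · subst hj; simp; ring
        · simp [hj, Ne.symm hj]; ring
      simp only [this, Finset.sum_add_distrib, ← Finset.sum_mul]
      simp [mul_comm]
    rw [e1, e2]
    exact h

theorem qb_noplane (Q : MvPolynomial (Fin 3) ℝ) (hQ : Q.IsHomogeneous 4)
    (hsm : ∀ v : Fin 3 → ℂ, v ≠ 0 →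
      MvPolynomial.eval v (MvPolynomial.map (algebraMap ℝ ℂ) Q) = 0 →
      ∃ i, MvPolynomial.eval v (MvPolynomial.pderiv i (MvPolynomial.map (algebraMap ℝ ℂ) Q)) ≠ 0)
    (p u : Fin 3 → ℝ) (hli : LinearIndependent ℝ ![p, u]) :
    ∃ x y : ℝ, MvPolynomial.eval (x • p + y • u) Q ≠ 0 := by
  by_contra! hz
  -- smoothness at real points
  have hsmR : ∀ v : Fin 3 → ℝ, v ≠ 0 → MvPolynomial.eval v Q = 0 →
      ∃ i, MvPolynomial.eval v (MvPolynomial.pderiv i Q) ≠ 0 := by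
    intro v hv hv0
    have key : ∀ R : MvPolynomial (Fin 3) ℝ,
        MvPolynomial.eval (fun i => (v i : ℂ)) (MvPolynomial.map (algebraMap ℝ ℂ) R)
          = ((MvPolynomial.eval v R : ℝ) : ℂ) := by
      intro R
      rw [MvPolynomial.eval_map]
      have := MvPolynomial.eval₂_comp_left (algebraMap ℝ ℂ) (RingHom.id ℝ) v R
      simp only [RingHom.comp_id] at this
      exact this.symm
    obtain ⟨i, hi⟩ := hsm (fun i => (v i : ℂ)) (by
      intro h
      apply hv
      funext i
      have := congrFun h i
      simpa using this) (by rw [key, hv0]; simp)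
    refine ⟨i, fun h => hi ?_⟩
    rw [MvPolynomial.pderiv_map, key, h]; simp
  obtain ⟨w, hw⟩ : ∃ w, w ∉ Submodule.span ℝ (Set.range ![p, u]) := by
    by_contra! h
    have h1 : Submodule.span ℝ (Set.range ![p, u]) = ⊤ := by
      rw [eq_top_iff]; intro x _; exact h x
    have h2 := finrank_span_eq_card hli
    rw [h1] at h2
    simp at h2
  have hli3 : LinearIndependent ℝ ![w, p, u] := by
    refine linearIndependent_finCons.mpr ?_
    exact ⟨hli, hw⟩
  have hspan : Submodule.span ℝ (Set.range ![w, p, u]) = ⊤ := by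
    apply hli3.span_eq_top_of_card_eq_finrank'
    simp
  let L : (Fin 3 → ℝ) → (Fin 3 → ℝ) →ₗ[ℝ] ℝ := fun v =>
    ∑ i, (MvPolynomial.eval v (MvPolynomial.pderiv i Q)) • LinearMap.proj i
  have hL : ∀ v z, L v z = ∑ i, z i * MvPolynomial.eval v (MvPolynomial.pderiv i Q) := by
    intro v z
    simp [L, mul_comm]
  let γ : ℝ → Fin 3 → ℝ := fun θ => Real.cos θ • p + Real.sin θ • u
  have hγ : Continuous γ := by fun_prop
  obtain ⟨θ, hθ⟩ : ∃ θ, L (γ θ) w = 0 := by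
    have hc : Continuous fun θ => L (γ θ) w := by
      simp only [hL]
      refine continuous_finsetSum _ fun i _ => continuous_const.mul ?_
      exact (MvPolynomial.continuous_eval _).comp hγ
    have hneg : L (γ Real.pi) w = - L (γ 0) w := by
      have : γ Real.pi = (-1 : ℝ) • γ 0 := by simp [γ]
      rw [this, hL, hL, ← Finset.sum_neg_distrib]
      refine Finset.sum_congr rfl fun i _ => ?_
      rw [qb_hom _ 3 (hQ.pderiv (i := i))]
      ring
    rcases le_total (L (γ 0) w) 0 with h | h
    · exact mem_range_of_exists_le_of_exists_ge hc ⟨0, h⟩ ⟨Real.pi, by rw [hneg]; linarith⟩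
    · exact mem_range_of_exists_le_of_exists_ge hc ⟨Real.pi, by rw [hneg]; linarith⟩ ⟨0, h⟩
  have hγ0 : γ θ ≠ 0 := by
    intro h
    have := LinearIndependent.pair_iff.mp hli _ _ h
    have h2 := Real.sin_sq_add_cos_sq θ
    rw [this.1, this.2] at h2
    norm_num at h2
  have htan : ∀ x y : ℝ, L (γ θ) (x • p + y • u) = 0 := by
    intro x y
    rw [hL]
    have h1 := qb_deriv Q (γ θ) (x • p + y • u)
    have h2 : (fun t : ℝ => MvPolynomial.eval (γ θ + t • (x • p + y • u)) Q) = fun _ => 0 := by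
      funext t
      rw [← hz (Real.cos θ + t * x) (Real.sin θ + t * y)]
      congr 2
      simp only [γ]
      module
    rw [h2] at h1
    exact h1.unique (hasDerivAt_const _ _)
  have hL0 : L (γ θ) = 0 := by
    apply LinearMap.ext_on_range hspan
    intro i
    fin_cases i
    · simpa using hθ
    · simpa using htan 1 0
    · simpa using htan 0 1
  obtain ⟨i, hi⟩ := hsmR (γ θ) hγ0 (hz _ _)
  apply hi
  have := congrArg (fun l => l (Pi.single i 1)) hL0
  simpa [hL, Pi.single_apply] using this

theorem qb_root_persist {U : Type*} [TopologicalSpace U] (f : U → ℝ → ℝ)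
    (hf : Continuous fun z : U × ℝ => f z.1 z.2) (u : U) (s : ℝ) (G : ℝ → ℝ)
    (hG : Continuous G) (hGs : G s ≠ 0) (hfac : ∀ x, f u x = (x - s) * G x)
    (N : Set ℝ) (hN : N ∈ nhds s) : ∀ᶠ u' in nhds u, ∃ x ∈ N, f u' x = 0 := by
  have h1 : ∀ᶠ x in nhds s, 0 < G x * G s := by
    have hc : Continuous fun x => G x * G s := hG.mul continuous_const
    exact hc.continuousAt.eventually (lt_mem_nhds (mul_self_pos.mpr hGs))
  obtain ⟨ε, hε, hball⟩ := Metric.mem_nhds_iff.mp (Filter.inter_mem hN h1)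
  have hsub : ∀ x, |x - s| ≤ ε / 2 → x ∈ N ∧ 0 < G x * G s := by
    intro x hx
    exact hball (by rw [Metric.mem_ball, Real.dist_eq]; linarith)
  have ha := hsub (s - ε / 2) (by rw [abs_le]; constructor <;> linarith)
  have hb := hsub (s + ε / 2) (by rw [abs_le]; constructor <;> linarith)
  have hab : f u (s - ε / 2) * f u (s + ε / 2) < 0 := by
    rw [hfac, hfac]
    have h3 : 0 < (G (s - ε / 2) * G s) * (G (s + ε / 2) * G s) := mul_pos ha.2 hb.2
    have h4 : 0 < G (s - ε / 2) * G (s + ε / 2) := by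
      have : 0 < (G (s - ε / 2) * G (s + ε / 2)) * (G s * G s) := by linarith
      exact (mul_pos_iff_of_pos_right (mul_self_pos.mpr hGs)).mp this
    have : 0 < (ε / 2) ^ 2 * (G (s - ε / 2) * G (s + ε / 2)) := by positivity
    linarith
  have hc : Continuous fun u' => f u' (s - ε / 2) * f u' (s + ε / 2) :=
    (hf.comp (continuous_id.prodMk continuous_const)).mul
      (hf.comp (continuous_id.prodMk continuous_const))
  filter_upwards [hc.continuousAt.eventually (gt_mem_nhds hab)] with u' hu'
  have hcu : ContinuousOn (f u') (Set.uIcc (s - ε / 2) (s + ε / 2)) :=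
    (hf.comp (continuous_const.prodMk continuous_id)).continuousOn
  have hmem : (0 : ℝ) ∈ Set.uIcc (f u' (s - ε / 2)) (f u' (s + ε / 2)) := by
    rw [Set.mem_uIcc]
    rcases mul_neg_iff.mp hu' with h | h
    · exact Or.inr ⟨h.2.le, h.1.le⟩
    · exact Or.inl ⟨h.1.le, h.2.le⟩
  obtain ⟨x, hx, hx0⟩ := intermediate_value_uIcc hcu hmem
  refine ⟨x, (hsub x ?_).1, hx0⟩
  rw [Set.uIcc_of_le (by linarith)] at hx
  rw [abs_le]
  constructor <;> linarith [hx.1, hx.2]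

/-- A partition of the cone over a zero set into three relatively closed conical pieces. -/
structure QBPart (q : (Fin 3 → ℝ) → ℝ) (C1 C2 C3 : Set (Fin 3 → ℝ)) : Prop where
  cl1 : IsClosed (insert 0 C1)
  cl2 : IsClosed (insert 0 C2)
  cl3 : IsClosed (insert 0 C3)
  sc1 : ∀ t : ℝ, t ≠ 0 → ∀ v ∈ C1, t • v ∈ C1
  sc2 : ∀ t : ℝ, t ≠ 0 → ∀ v ∈ C2, t • v ∈ C2
  sc3 : ∀ t : ℝ, t ≠ 0 → ∀ v ∈ C3, t • v ∈ C3
  nz1 : ∀ v ∈ C1, v ≠ 0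
  nz2 : ∀ v ∈ C2, v ≠ 0
  nz3 : ∀ v ∈ C3, v ≠ 0
  rt1 : ∀ v ∈ C1, q v = 0
  rt2 : ∀ v ∈ C2, q v = 0
  rt3 : ∀ v ∈ C3, q v = 0
  d12 : ∀ v ∈ C1, v ∉ C2
  d13 : ∀ v ∈ C1, v ∉ C3
  d23 : ∀ v ∈ C2, v ∉ C3
  cov : ∀ v, v ≠ 0 → q v = 0 → v ∈ C1 ∨ v ∈ C2 ∨ v ∈ C3

theorem QBPart.swap12 {q : (Fin 3 → ℝ) → ℝ} {C1 C2 C3 : Set (Fin 3 → ℝ)}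
    (h : QBPart q C1 C2 C3) : QBPart q C2 C1 C3 where
  cl1 := h.cl2
  cl2 := h.cl1
  cl3 := h.cl3
  sc1 := h.sc2
  sc2 := h.sc1
  sc3 := h.sc3
  nz1 := h.nz2
  nz2 := h.nz1
  nz3 := h.nz3
  rt1 := h.rt2
  rt2 := h.rt1
  rt3 := h.rt3
  d12 := fun v hv hv' => h.d12 v hv' hv
  d13 := h.d23
  d23 := h.d13
  cov := fun v h1 h2 => by have := h.cov v h1 h2; tauto

theorem QBPart.swap23 {q : (Fin 3 → ℝ) → ℝ} {C1 C2 C3 : Set (Fin 3 → ℝ)}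
    (h : QBPart q C1 C2 C3) : QBPart q C1 C3 C2 where
  cl1 := h.cl1
  cl2 := h.cl3
  cl3 := h.cl2
  sc1 := h.sc1
  sc2 := h.sc3
  sc3 := h.sc2
  nz1 := h.nz1
  nz2 := h.nz3
  nz3 := h.nz2
  rt1 := h.rt1
  rt2 := h.rt3
  rt3 := h.rt2
  d12 := h.d13
  d13 := h.d12
  d23 := fun v hv hv' => h.d23 v hv' hv
  cov := fun v h1 h2 => by have := h.cov v h1 h2; tauto

/-- Boundedness of the affine parameter near the pencil centre. -/
theorem qb_bdd {C : Set (Fin 3 → ℝ)} (cl : IsClosed (insert 0 C))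
    (sc : ∀ t : ℝ, t ≠ 0 → ∀ v ∈ C, t • v ∈ C) (p : Fin 3 → ℝ) (hp0 : p ≠ 0) (hp : p ∉ C)
    (M : ℝ) : ∃ R : ℝ, ∀ (u : Fin 3 → ℝ) (s : ℝ), ‖u‖ ≤ M → s • p + u ∈ C → |s| ≤ R := by
  have hpn : p ∈ (insert 0 C)ᶜ := by simp [hp0, hp]
  obtain ⟨ε, hε, hball⟩ := Metric.isOpen_iff.mp cl.isOpen_compl p hpn
  refine ⟨|M| / ε + 1, fun u s hu hs => ?_⟩
  by_contra! hlt
  have hs1 : 0 < |s| := lt_trans (by positivity) hlt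
  have hs0 : s ≠ 0 := abs_pos.mp hs1
  have hin : p + s⁻¹ • u ∈ C := by
    have := sc s⁻¹ (inv_ne_zero hs0) _ hs
    rwa [smul_add, smul_smul, inv_mul_cancel₀ hs0, one_smul] at this
  have : p + s⁻¹ • u ∈ Metric.ball p ε := by
    rw [Metric.mem_ball, dist_eq_norm, add_sub_cancel_left, norm_smul, norm_inv, Real.norm_eq_abs]
    rw [inv_mul_lt_iff₀ hs1]
    have h1 : |M| / ε < |s| := by linarith
    rw [div_lt_iff₀ hε] at h1
    linarith [le_abs_self M]
  exact hball this (Or.inr hin)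

theorem qb_core_lt (q : (Fin 3 → ℝ) → ℝ) (hqc : Continuous q)
    (hhom : ∀ (t : ℝ) v, q (t • v) = t ^ 4 * q v)
    (p : Fin 3 → ℝ) (hnp : ∀ u, LinearIndependent ℝ ![p, u] → ∃ x y : ℝ, q (x • p + y • u) ≠ 0)
    (c0 c1 c2 c3 : (Fin 3 → ℝ) → ℝ) (hc2 : Continuous c2) (hc3 : Continuous c3)
    (hexp : ∀ (u : Fin 3 → ℝ) (s : ℝ), q (s • p + u) =
        c0 u + c1 u * s + c2 u * s ^ 2 + c3 u * s ^ 3)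
    (C1 C2 C3 : Set (Fin 3 → ℝ)) (H : QBPart q C1 C2 C3) (hp : p ∈ C3)
    (u₀ : Fin 3 → ℝ) (s₁ s₂ : ℝ) (hs : s₂ < s₁) (h1 : s₁ • p + u₀ ∈ C1) (h2 : s₂ • p + u₀ ∈ C2)
    (h3 : (-(c2 u₀ + c3 u₀ * (s₁ + s₂))) • p + c3 u₀ • u₀ ∈ C3) : False := by
  have hp0 : p ≠ 0 := H.nz3 p hp
  have hp1 : p ∉ C1 := fun h => H.d13 p h hp
  have hp2 : p ∉ C2 := fun h => H.d23 p h hp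
  have hqp : q p = 0 := H.rt3 p hp
  -- the third root
  let P : (Fin 3 → ℝ) → ℝ → ℝ → (Fin 3 → ℝ) := fun u a b =>
    (-(c2 u + c3 u * (a + b))) • p + c3 u • u
  have hPc : Continuous fun z : (Fin 3 → ℝ) × ℝ × ℝ => P z.1 z.2.1 z.2.2 := by
    simp only [P]; fun_prop
  have hfac : ∀ u a b, a ≠ b → q (a • p + u) = 0 → q (b • p + u) = 0 → ∀ x : ℝ,
      q (x • p + u) = (x - a) * ((x - b) * (c3 u * x + (c2 u + c3 u * (a + b)))) := by
    intro u a b hab ha hb x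
    rw [hexp] at ha hb ⊢
    have hE : c1 u + c2 u * (a + b) + c3 u * (a ^ 2 + a * b + b ^ 2) = 0 := by
      have : (a - b) * (c1 u + c2 u * (a + b) + c3 u * (a ^ 2 + a * b + b ^ 2)) = 0 := by
        linear_combination ha - hb
      exact (mul_eq_zero.mp this).resolve_left (sub_ne_zero.mpr hab)
    linear_combination ha + (x - a) * hE
  have hPq : ∀ u a b, a ≠ b → q (a • p + u) = 0 → q (b • p + u) = 0 → q (P u a b) = 0 := by
    intro u a b hab ha hb
    have hf := hfac u a b hab ha hb
    by_cases hA : c3 u = 0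
    · simp [P, hA, hqp, hhom, -neg_smul]
    · have : P u a b = c3 u • ((-(c2 u + c3 u * (a + b)) / c3 u) • p + u) := by
        simp only [P, smul_add, smul_smul]
        congr 2
        field_simp
      rw [this, hhom, hf]
      have : c3 u * (-(c2 u + c3 u * (a + b)) / c3 u) + (c2 u + c3 u * (a + b)) = 0 := by
        field_simp; ring
      rw [this]; ring
  have hPx : ∀ u a b x, c3 u * x + (c2 u + c3 u * (a + b)) = 0 → P u a b = c3 u • (x • p + u) := by
    intro u a b x hx
    have : -(c2 u + c3 u * (a + b)) = c3 u * x := by linear_combination -hx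
    simp only [P, this, smul_add, smul_smul]
  have hPne : ∀ u a b x, P u a b ∈ C3 → x • p + u ∉ C3 →
      c3 u * x + (c2 u + c3 u * (a + b)) ≠ 0 := by
    intro u a b x hP hx h0
    rw [hPx u a b x h0] at hP
    have hc : c3 u ≠ 0 := by
      intro h
      exact H.nz3 _ hP (by rw [h, zero_smul])
    apply hx
    have := H.sc3 (c3 u)⁻¹ (inv_ne_zero hc) _ hP
    rwa [smul_smul, inv_mul_cancel₀ hc, one_smul] at this
  let T : Set (Fin 3 → ℝ) := {u | ∃ a b : ℝ, b < a ∧ a • p + u ∈ C1 ∧ b • p + u ∈ C2 ∧ P u a b ∈ C3}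
  let E : Submodule ℝ (Fin 3 → ℝ) := Submodule.span ℝ {p}
  have hTE : ∀ u ∈ T, u ∉ E := by
    rintro u ⟨a, b, -, ha, -, -⟩ hu
    obtain ⟨l, rfl⟩ := Submodule.mem_span_singleton.mp hu
    rw [← add_smul] at ha
    have hne : a + l ≠ 0 := fun h => H.nz1 _ ha (by rw [h, zero_smul])
    apply hp1
    have := H.sc1 (a + l)⁻¹ (inv_ne_zero hne) _ ha
    rwa [smul_smul, inv_mul_cancel₀ hne, one_smul] at this
  have hconn : IsConnected ((E : Set (Fin 3 → ℝ))ᶜ) := by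
    apply isConnected_compl_of_one_lt_codim
    have h1 := Submodule.finrank_quotient_add_finrank E
    have h2 : Module.finrank ℝ E = 1 := finrank_span_singleton hp0
    rw [h2] at h1
    simp only [Module.finrank_fintype_fun_eq_card, Fintype.card_fin] at h1
    have h3 : Module.finrank ℝ ((Fin 3 → ℝ) ⧸ E) = 2 := by omega
    rw [← Module.finrank_eq_rank, h3]
    norm_num
  have hopen : IsOpen T := by
    rw [isOpen_iff_mem_nhds]
    rintro u ⟨a, b, hab, ha, hb, hP⟩
    have hF := hfac u a b hab.ne' (H.rt1 _ ha) (H.rt2 _ hb)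
    have hqf : Continuous fun z : (Fin 3 → ℝ) × ℝ => (fun u x => q (x • p + u)) z.1 z.2 := by
      refine hqc.comp ?_; fun_prop
    have ev : ∀ᶠ z : (Fin 3 → ℝ) × ℝ × ℝ in nhds (u, a, b), z.2.2 < z.2.1 ∧
        z.2.1 • p + z.1 ∉ insert 0 C2 ∧ z.2.1 • p + z.1 ∉ insert 0 C3 ∧
        z.2.2 • p + z.1 ∉ insert 0 C1 ∧ z.2.2 • p + z.1 ∉ insert 0 C3 ∧
        P z.1 z.2.1 z.2.2 ∉ insert 0 C1 ∧ P z.1 z.2.1 z.2.2 ∉ insert 0 C2 := by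
      have k1 : Continuous fun z : (Fin 3 → ℝ) × ℝ × ℝ => z.2.1 • p + z.1 := by fun_prop
      have k2 : Continuous fun z : (Fin 3 → ℝ) × ℝ × ℝ => z.2.2 • p + z.1 := by fun_prop
      have gen : ∀ (F : (Fin 3 → ℝ) × ℝ × ℝ → (Fin 3 → ℝ)) (D : Set (Fin 3 → ℝ)), Continuous F →
          IsClosed (insert 0 D) → F (u, a, b) ≠ 0 → F (u, a, b) ∉ D →
          ∀ᶠ z in nhds (u, a, b), F z ∉ insert 0 D := by
        intro F D hFc hD hF0 hFD
        apply hFc.continuousAt.eventually (hD.isOpen_compl.mem_nhds _)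
        simp [hF0, hFD]
      refine Filter.Eventually.and ?_ (Filter.Eventually.and ?_ (Filter.Eventually.and ?_
        (Filter.Eventually.and ?_ (Filter.Eventually.and ?_ (Filter.Eventually.and ?_ ?_)))))
      · exact (isOpen_lt (f := fun z : (Fin 3 → ℝ) × ℝ × ℝ => z.2.2) (g := fun z => z.2.1)
          (by fun_prop) (by fun_prop)).mem_nhds hab
      · exact gen _ _ k1 H.cl2 (H.nz1 _ ha) (H.d12 _ ha)
      · exact gen _ _ k1 H.cl3 (H.nz1 _ ha) (H.d13 _ ha)
      · exact gen _ _ k2 H.cl1 (H.nz2 _ hb) (fun h => H.d12 _ h hb)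
      · exact gen _ _ k2 H.cl3 (H.nz2 _ hb) (H.d23 _ hb)
      · exact gen _ _ hPc H.cl1 (H.nz3 _ hP) (fun h => H.d13 _ h hP)
      · exact gen _ _ hPc H.cl2 (H.nz3 _ hP) (fun h => H.d23 _ h hP)
    rw [nhds_prod_eq, nhds_prod_eq] at ev
    obtain ⟨U, hU, W, hW, hUW⟩ := Filter.mem_prod_iff.mp ev
    obtain ⟨N1, hN1, N2, hN2, hN⟩ := Filter.mem_prod_iff.mp hW
    have r1 := qb_root_persist (fun u x => q (x • p + u)) hqf u a
      (fun x => (x - b) * (c3 u * x + (c2 u + c3 u * (a + b)))) (by fun_prop)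
      (mul_ne_zero (sub_ne_zero.mpr hab.ne') (hPne u a b a hP (H.d13 _ ha))) hF N1 hN1
    have r2 := qb_root_persist (fun u x => q (x • p + u)) hqf u b
      (fun x => (x - a) * (c3 u * x + (c2 u + c3 u * (a + b)))) (by fun_prop)
      (mul_ne_zero (sub_ne_zero.mpr hab.ne) (hPne u a b b hP (H.d23 _ hb)))
      (fun x => by rw [hF]; ring) N2 hN2
    filter_upwards [hU, r1, r2] with u' hu' ⟨a', ha', qa'⟩ ⟨b', hb', qb'⟩
    obtain ⟨e1, e2, e3, e4, e5, e6, e7⟩ := hUW (Set.mk_mem_prod hu' (hN (Set.mk_mem_prod ha' hb')))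
    simp only [Set.mem_insert_iff, not_or] at e2 e3 e4 e5 e6 e7
    refine ⟨a', b', e1, ?_, ?_, ?_⟩
    · have := H.cov _ e2.1 qa'
      tauto
    · have := H.cov _ e4.1 qb'
      tauto
    · have := H.cov _ e6.1 (hPq u' a' b' (ne_of_gt e1) qa' qb')
      tauto
  have hclosed : closure T ∩ (E : Set (Fin 3 → ℝ))ᶜ ⊆ T := by
    rintro u ⟨hu, huE⟩
    obtain ⟨un, hunT, hun⟩ := mem_closure_iff_seq_limit.mp hu
    choose a b hab ha hb hP using hunT
    obtain ⟨M, hM⟩ := (Metric.isBounded_range_of_tendsto un hun).exists_norm_le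
    obtain ⟨R1, hR1⟩ := qb_bdd H.cl1 H.sc1 p hp0 hp1 M
    obtain ⟨R2, hR2⟩ := qb_bdd H.cl2 H.sc2 p hp0 hp2 M
    have hbd : ∀ n, (a n, b n) ∈ Set.Icc (-R1) R1 ×ˢ Set.Icc (-R2) R2 := by
      intro n
      have hn := hM (un n) (Set.mem_range_self n)
      exact ⟨abs_le.mp (hR1 _ _ hn (ha n)), abs_le.mp (hR2 _ _ hn (hb n))⟩
    obtain ⟨⟨a', b'⟩, -, φ, hφ, hlim⟩ := (isCompact_Icc.prod isCompact_Icc).tendsto_subseq hbd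
    have hlim3 : Filter.Tendsto (fun n => (un (φ n), a (φ n), b (φ n))) Filter.atTop
        (nhds (u, a', b')) := (hun.comp hφ.tendsto_atTop).prodMk_nhds hlim
    have k1 : Continuous fun z : (Fin 3 → ℝ) × ℝ × ℝ => z.2.1 • p + z.1 := by fun_prop
    have k2 : Continuous fun z : (Fin 3 → ℝ) × ℝ × ℝ => z.2.2 • p + z.1 := by fun_prop
    have l1 : a' • p + u ∈ insert 0 C1 := H.cl1.mem_of_tendsto ((k1.tendsto _).comp hlim3)
      (Filter.Eventually.of_forall fun n => Or.inr (ha (φ n)))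
    have l2 : b' • p + u ∈ insert 0 C2 := H.cl2.mem_of_tendsto ((k2.tendsto _).comp hlim3)
      (Filter.Eventually.of_forall fun n => Or.inr (hb (φ n)))
    have l3 : P u a' b' ∈ insert 0 C3 := H.cl3.mem_of_tendsto ((hPc.tendsto _).comp hlim3)
      (Filter.Eventually.of_forall fun n => Or.inr (hP (φ n)))
    have hle : b' ≤ a' := le_of_tendsto_of_tendsto
      (((continuous_snd.comp continuous_snd).tendsto (u, a', b')).comp hlim3)
      (((continuous_fst.comp continuous_snd).tendsto (u, a', b')).comp hlim3)
      (Filter.Eventually.of_forall fun n => (hab (φ n)).le)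
    have hnz : ∀ x : ℝ, x • p + u ≠ 0 := by
      intro x hx
      apply huE
      have : u = (-x) • p := by
        rw [neg_smul]; exact eq_neg_of_add_eq_zero_right hx
      rw [this]
      exact Submodule.smul_mem _ _ (Submodule.mem_span_singleton_self p)
    have m1 : a' • p + u ∈ C1 := l1.resolve_left (hnz a')
    have m2 : b' • p + u ∈ C2 := l2.resolve_left (hnz b')
    have hlt : b' < a' := by
      refine lt_of_le_of_ne hle ?_
      rintro rfl
      exact H.d12 _ m1 m2
    refine ⟨a', b', hlt, m1, m2, l3.resolve_left ?_⟩
    intro hP0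
    have hli : LinearIndependent ℝ ![p, u] := by
      rw [LinearIndependent.pair_iff' hp0]
      intro t ht
      apply huE
      rw [← ht]
      exact Submodule.smul_mem _ _ (Submodule.mem_span_singleton_self p)
    have hz := LinearIndependent.pair_iff.mp hli _ _ hP0
    obtain ⟨x, y, hxy⟩ := hnp u hli
    apply hxy
    have hF := hfac u a' b' hlt.ne' (H.rt1 _ m1) (H.rt2 _ m2)
    have hF0 : ∀ x : ℝ, q (x • p + u) = 0 := by
      intro x
      rw [hF, hz.2, show c2 u + 0 * (a' + b') = 0 by have := hz.1; rw [hz.2] at this; linarith]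
      ring
    by_cases hy : y = 0
    · rw [hy, zero_smul, add_zero, hhom, hqp, mul_zero]
    · have : x • p + y • u = y • ((x / y) • p + u) := by
        rw [smul_add, smul_smul, mul_div_cancel₀ _ hy]
      rw [this, hhom, hF0, mul_zero]
  have hu0 : u₀ ∈ T := ⟨s₁, s₂, hs, h1, h2, h3⟩
  have hall := hconn.isPreconnected.subset_of_closure_inter_subset hopen
    ⟨u₀, hTE u₀ hu0, hu0⟩ hclosed
  have hneg : -u₀ ∈ T := hall (by
    intro h
    exact hTE u₀ hu0 (by simpa using E.neg_mem h))
  obtain ⟨a, b, hab, ha, hb, -⟩ := hneg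
  have hF := hfac u₀ s₁ s₂ hs.ne' (H.rt1 _ h1) (H.rt2 _ h2)
  have ha' : (-a) • p + u₀ ∈ C1 := by
    have := H.sc1 (-1) (by norm_num) _ ha
    simpa [smul_add] using this
  have hb' : (-b) • p + u₀ ∈ C2 := by
    have := H.sc2 (-1) (by norm_num) _ hb
    simpa [smul_add] using this
  have ea : -a = s₁ := by
    have h := hF (-a)
    rw [H.rt1 _ ha'] at h
    rcases mul_eq_zero.mp h.symm with h | h
    · linarith
    rcases mul_eq_zero.mp h with h | h
    · exfalso
      have : -a = s₂ := by linarith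
      rw [this] at ha'
      exact H.d12 _ ha' h2
    · exact absurd h (hPne u₀ s₁ s₂ _ h3 (H.d13 _ ha'))
  have eb : -b = s₂ := by
    have h := hF (-b)
    rw [H.rt2 _ hb'] at h
    rcases mul_eq_zero.mp h.symm with h | h
    · exfalso
      have : -b = s₁ := by linarith
      rw [this] at hb'
      exact H.d12 _ h1 hb'
    rcases mul_eq_zero.mp h with h | h
    · linarith
    · exact absurd h (hPne u₀ s₁ s₂ _ h3 (H.d23 _ hb'))
  linarith

theorem qb_core (Q : MvPolynomial (Fin 3) ℝ) (hQ : Q.IsHomogeneous 4)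
    (hsm : ∀ v : Fin 3 → ℂ, v ≠ 0 →
      MvPolynomial.eval v (MvPolynomial.map (algebraMap ℝ ℂ) Q) = 0 →
      ∃ i, MvPolynomial.eval v (MvPolynomial.pderiv i (MvPolynomial.map (algebraMap ℝ ℂ) Q)) ≠ 0)
    (C1 C2 C3 : Set (Fin 3 → ℝ)) (H : QBPart (fun v => MvPolynomial.eval v Q) C1 C2 C3)
    (p : Fin 3 → ℝ) (hp : p ∈ C3) (u : Fin 3 → ℝ) (s₁ s₂ : ℝ) (hs : s₁ ≠ s₂)
    (h1 : s₁ • p + u ∈ C1) (h2 : s₂ • p + u ∈ C2) (A B : ℝ)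
    (hAB : ∀ x : ℝ, MvPolynomial.eval (x • p + u) Q = (x - s₁) * (x - s₂) * (A * x + B))
    (h3 : (-B) • p + A • u ∈ C3) : False := by
  obtain ⟨c0, c1, c2, c3, hc2, hc3, hexp⟩ := qb_coeffs Q hQ p
  have hqp : MvPolynomial.eval p Q = 0 := H.rt3 p hp
  have hexp' : ∀ (u : Fin 3 → ℝ) (s : ℝ), MvPolynomial.eval (s • p + u) Q =
        c0 u + c1 u * s + c2 u * s ^ 2 + c3 u * s ^ 3 := by
    intro u s
    rw [hexp, hqp]; ring
  have eqs : ∀ x : ℝ, c0 u + c1 u * x + c2 u * x ^ 2 + c3 u * x ^ 3 =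
      (x - s₁) * (x - s₂) * (A * x + B) := fun x => by rw [← hexp', hAB]
  have e0 := eqs 0
  have e1 := eqs 1
  have e2 := eqs (-1)
  have e3 := eqs 2
  have hA : c3 u = A := by linear_combination (e3 - 3 * e1 + 3 * e0 - e2) / 6
  have hB : c2 u + c3 u * (s₁ + s₂) = B := by
    rw [hA]; linear_combination (e1 + e2 - 2 * e0) / 2
  have hnp := qb_noplane Q hQ hsm p
  have hq := MvPolynomial.continuous_eval Q
  have hhom := fun (t : ℝ) v => qb_hom Q 4 hQ t v
  rcases lt_or_gt_of_ne hs with h | h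
  · refine qb_core_lt _ hq hhom p hnp c0 c1 c2 c3 hc2 hc3 hexp' C2 C1 C3 H.swap12 hp u s₂ s₁ h h2 h1 ?_
    rw [add_comm s₂ s₁, hB, hA]
    exact h3
  · refine qb_core_lt _ hq hhom p hnp c0 c1 c2 c3 hc2 hc3 hexp' C1 C2 C3 H hp u s₁ s₂ h h1 h2 ?_
    rw [hB, hA]
    exact h3

theorem qb_collinear (Q : MvPolynomial (Fin 3) ℝ) (hQ : Q.IsHomogeneous 4)
    (hsm : ∀ v : Fin 3 → ℂ, v ≠ 0 →
      MvPolynomial.eval v (MvPolynomial.map (algebraMap ℝ ℂ) Q) = 0 →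
      ∃ i, MvPolynomial.eval v (MvPolynomial.pderiv i (MvPolynomial.map (algebraMap ℝ ℂ) Q)) ≠ 0)
    (C1 C2 C3 : Set (Fin 3 → ℝ)) (H : QBPart (fun v => MvPolynomial.eval v Q) C1 C2 C3)
    (a b : Fin 3 → ℝ) (ha : a ∈ C1) (hb : b ∈ C2) (hp : a + b ∈ C3) : False := by
  obtain ⟨c0, c1, c2, c3, -, -, hexp⟩ := qb_coeffs Q hQ a
  have hqa : MvPolynomial.eval a Q = 0 := H.rt1 a ha
  have hqb : MvPolynomial.eval b Q = 0 := H.rt2 b hb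
  have hqp : MvPolynomial.eval (a + b) Q = 0 := H.rt3 _ hp
  have e0 := hexp b 0
  have e1 := hexp b 1
  rw [one_smul, hqp, hqa] at e1
  rw [zero_smul, zero_add, hqb, hqa] at e0
  have hhom := fun (t : ℝ) v => qb_hom Q 4 hQ t v
  obtain ⟨α, hα⟩ : ∃ α, α = c3 b := ⟨_, rfl⟩
  obtain ⟨γ, hγ⟩ : ∃ γ, γ = c1 b := ⟨_, rfl⟩
  have hx : ∀ x : ℝ, MvPolynomial.eval (x • a + b) Q = x * (x - 1) * (α * x - γ) := by
    intro x
    rw [hexp, hqa, hα, hγ]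
    linear_combination (x ^ 2 - 1) * e0 - x ^ 2 * e1
  have hxy : ∀ x y : ℝ, MvPolynomial.eval (x • a + y • b) Q =
      x * y * (x - y) * (α * x - γ * y) := by
    intro x y
    by_cases hy : y = 0
    · rw [hy, zero_smul, add_zero, hhom, hqa]; ring
    · have : x • a + y • b = y • ((x / y) • a + b) := by
        rw [smul_add, smul_smul, mul_div_cancel₀ _ hy]
      rw [this, hhom, hx]
      field_simp
  have hli : LinearIndependent ℝ ![a, b] := by
    rw [LinearIndependent.pair_iff' (H.nz1 a ha)]
    intro t ht
    have ht0 : t ≠ 0 := by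
      rintro rfl
      exact H.nz2 b hb (by rw [← ht, zero_smul])
    exact H.d12 b (ht ▸ H.sc1 t ht0 a ha) hb
  have hd0 : γ • a + α • b ≠ 0 := by
    intro h
    have := LinearIndependent.pair_iff.mp hli _ _ h
    obtain ⟨x, y, hne⟩ := qb_noplane Q hQ hsm a b hli
    apply hne
    rw [hxy, this.1, this.2]; ring
  have hdq : MvPolynomial.eval (γ • a + α • b) Q = 0 := by rw [hxy]; ring
  rcases H.cov _ hd0 hdq with hd | hd | hd
  · -- centre `a`
    refine qb_core Q hQ hsm C3 C2 C1 H.swap12.swap23.swap12 a ha b 1 0 (by norm_num)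
      (by simpa using hp) (by simpa using hb) α (-γ) (fun x => by rw [hx]; ring) ?_
    simpa using hd
  · refine qb_core Q hQ hsm C1 C3 C2 H.swap23 b hb a 0 1 (by norm_num)
      (by simpa using ha) (by simpa [add_comm] using hp) γ (-α) (fun x => ?_) ?_
    · have := hxy 1 x
      rw [one_smul] at this
      rw [add_comm, this]; ring
    · rw [add_comm]; simpa using hd
  · refine qb_core Q hQ hsm C1 C2 C3 H (a + b) hp a 0 (-1) (by norm_num)
      (by simpa using ha) ?_ (α - γ) α (fun x => ?_) ?_
    · have := H.sc2 (-1) (by norm_num) _ hb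
      simpa using this
    · have := hxy (x + 1) x
      rw [show x • (a + b) + a = (x + 1) • a + x • b by module, this]; ring
    · have := H.sc3 (-1) (by norm_num) _ hd
      rw [show (-α) • (a + b) + (α - γ) • a = (-1 : ℝ) • (γ • a + α • b) by module]
      exact this

theorem qb_quot : Topology.IsQuotientMap
    (Projectivization.mk' ℝ : {v : Fin 3 → ℝ // v ≠ 0} → Proj 2) :=
  isQuotientMap_quot_mk

theorem qb_rep (v : Fin 3 → ℝ) (hv : v ≠ 0) :
    ∃ a : ℝ, a ≠ 0 ∧ (Projectivization.mk ℝ v hv).rep = a • v := by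
  obtain ⟨a, ha⟩ := Projectivization.exists_smul_eq_mk_rep ℝ v hv
  exact ⟨a, a.ne_zero, ha.symm⟩

theorem qb_sumsq (v : Fin 3 → ℝ) (hv : v ≠ 0) : ∑ k, v k ^ 2 ≠ 0 := by
  intro h
  apply hv
  funext i
  have := (Finset.sum_eq_zero_iff_of_nonneg (fun k _ => sq_nonneg (v k))).mp h i (Finset.mem_univ i)
  simpa using this

theorem qb_t2 : T2Space (Proj 2) := by
  let F : Proj 2 → Fin 3 → Fin 3 → ℝ := fun x i j => x.rep i * x.rep j / ∑ k, x.rep k ^ 2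
  have hF : ∀ v : {v : Fin 3 → ℝ // v ≠ 0}, F (Projectivization.mk' ℝ v) =
      fun i j => v.1 i * v.1 j / ∑ k, v.1 k ^ 2 := by
    rintro ⟨v, hv⟩
    obtain ⟨a, ha, h⟩ := qb_rep v hv
    funext i j
    simp only [F, Projectivization.mk'_eq_mk, h, Pi.smul_apply, smul_eq_mul, mul_pow,
      ← Finset.mul_sum]
    have := qb_sumsq v hv
    field_simp
  have hc : Continuous F := by
    rw [qb_quot.continuous_iff]
    have : F ∘ Projectivization.mk' ℝ = fun (v : {v : Fin 3 → ℝ // v ≠ 0}) i j =>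
      v.1 i * v.1 j / ∑ k, v.1 k ^ 2 := funext hF
    rw [this]
    have hco : ∀ i, Continuous fun v : {v : Fin 3 → ℝ // v ≠ 0} => v.1 i :=
      fun i => (continuous_apply i).comp continuous_subtype_val
    refine continuous_pi fun i => continuous_pi fun j => Continuous.div ?_ ?_ ?_
    · exact (hco i).mul (hco j)
    · exact continuous_finsetSum _ fun k _ => (hco k).pow 2
    · intro v; exact qb_sumsq v.1 v.2
  refine T2Space.of_injective_continuous (f := F) ?_ hc
  intro x y hxy
  rw [← x.mk_rep, ← y.mk_rep, Projectivization.mk_eq_mk_iff']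
  obtain ⟨j, hj⟩ : ∃ j, y.rep j ≠ 0 := by
    by_contra! h
    exact y.rep_nonzero (funext h)
  have hx := qb_sumsq _ x.rep_nonzero
  have hy := qb_sumsq _ y.rep_nonzero
  have h1 : ∀ i, x.rep i * x.rep j * (∑ k, y.rep k ^ 2) = y.rep i * y.rep j * ∑ k, x.rep k ^ 2 := by
    intro i
    have := congrFun (congrFun hxy i) j
    simp only [F] at this
    rwa [div_eq_div_iff hx hy] at this
  have hxj : x.rep j ≠ 0 := by
    intro h0
    have := h1 j
    rw [h0] at this
    have h2 : y.rep j * y.rep j * ∑ k, x.rep k ^ 2 ≠ 0 := mul_ne_zero (mul_ne_zero hj hj) hx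
    apply h2; rw [← this]; ring
  refine ⟨(y.rep j * ∑ k, x.rep k ^ 2) / (x.rep j * ∑ k, y.rep k ^ 2), ?_⟩
  funext i
  have := h1 i
  simp only [Pi.smul_apply, smul_eq_mul]
  field_simp
  linarith

theorem qb_compact : CompactSpace (Proj 2) := by
  have hne : ∀ v : Metric.sphere (0 : Fin 3 → ℝ) 1, v.1 ≠ 0 := by
    intro v h
    have := v.2
    simp [h] at this
  let F : Metric.sphere (0 : Fin 3 → ℝ) 1 → Proj 2 := fun v => Projectivization.mk' ℝ ⟨v.1, hne v⟩
  have hc : Continuous F := qb_quot.continuous.comp (by fun_prop)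
  have hs : Function.Surjective F := by
    intro x
    have h0 : ‖x.rep‖ ≠ 0 := norm_ne_zero_iff.mpr x.rep_nonzero
    refine ⟨⟨‖x.rep‖⁻¹ • x.rep, ?_⟩, ?_⟩
    · simp [norm_smul, h0]
    · simp only [F, Projectivization.mk'_eq_mk]
      conv_rhs => rw [← x.mk_rep]
      rw [Projectivization.mk_eq_mk_iff']
      exact ⟨_, rfl⟩
  have := hs.range_eq
  refine ⟨?_⟩
  rw [← this]
  exact isCompact_range hc

/-- The cone (without the origin) over a subset of the projective plane. -/
def qbCone (W : Set (Proj 2)) : Set (Fin 3 → ℝ) :=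
  {v | ∃ h : v ≠ 0, Projectivization.mk ℝ v h ∈ W}

theorem qbCone_rep {W : Set (Proj 2)} {x : Proj 2} : x.rep ∈ qbCone W ↔ x ∈ W := by
  constructor
  · rintro ⟨h, hx⟩
    rwa [Projectivization.mk_rep] at hx
  · intro h
    exact ⟨x.rep_nonzero, by rwa [Projectivization.mk_rep]⟩

theorem qbCone_smul {W : Set (Proj 2)} (t : ℝ) (ht : t ≠ 0) (v : Fin 3 → ℝ) (hv : v ∈ qbCone W) :
    t • v ∈ qbCone W := by
  obtain ⟨h, hW⟩ := hv
  refine ⟨smul_ne_zero ht h, ?_⟩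
  have : Projectivization.mk ℝ (t • v) (smul_ne_zero ht h) = Projectivization.mk ℝ v h := by
    rw [Projectivization.mk_eq_mk_iff']
    exact ⟨t, rfl⟩
  rwa [this]

theorem qbCone_closed {W : Set (Proj 2)} (hW : IsClosed W) : IsClosed (insert 0 (qbCone W)) := by
  have h1 : IsOpen ((Projectivization.mk' ℝ : {v : Fin 3 → ℝ // v ≠ 0} → Proj 2) ⁻¹' Wᶜ) :=
    hW.isOpen_compl.preimage qb_quot.continuous
  have h2 : IsOpen {v : Fin 3 → ℝ | v ≠ 0} := isOpen_ne
  have h3 := h2.isOpenMap_subtype_val _ h1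
  rw [← isOpen_compl_iff]
  convert h3 using 1
  ext v
  simp only [Set.mem_compl_iff, Set.mem_insert_iff, not_or, qbCone, Set.mem_ofPred_eq, not_exists,
    Set.mem_image, Set.mem_preimage, Subtype.exists, exists_and_right, exists_eq_right,
    Projectivization.mk'_eq_mk]
  constructor
  · rintro ⟨h, h'⟩
    exact ⟨h, h' h⟩
  · rintro ⟨h, h'⟩
    exact ⟨h, fun _ => h'⟩

theorem qb_partition (Q : MvPolynomial (Fin 3) ℝ) (hQ : Q.IsHomogeneous 4)
    (Z : Set (Proj 2)) (hZ : Z = {x : Proj 2 | MvPolynomial.eval x.rep Q = 0}) :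
    IsClosed Z ∧ ∀ (x₁ x₂ x₃ : Proj 2), x₁ ∈ Z → x₂ ∈ Z → x₃ ∈ Z →
      connectedComponentIn Z x₁ ≠ connectedComponentIn Z x₂ →
      connectedComponentIn Z x₁ ≠ connectedComponentIn Z x₃ →
      connectedComponentIn Z x₂ ≠ connectedComponentIn Z x₃ →
      ∃ W₁ W₂ W₃ : Set (Proj 2), connectedComponentIn Z x₁ ⊆ W₁ ∧
        connectedComponentIn Z x₂ ⊆ W₂ ∧ connectedComponentIn Z x₃ ⊆ W₃ ∧
        QBPart (fun v => MvPolynomial.eval v Q) (qbCone W₁) (qbCone W₂) (qbCone W₃) := by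
  have := qb_t2
  have := qb_compact
  have hmk : ∀ v (hv : v ≠ 0), Projectivization.mk ℝ v hv ∈ Z ↔ MvPolynomial.eval v Q = 0 := by
    intro v hv
    obtain ⟨a, ha, h⟩ := qb_rep v hv
    rw [hZ, Set.mem_ofPred_eq, h, qb_hom Q 4 hQ]
    simp [ha]
  have hcl : IsClosed Z := by
    rw [← qb_quot.isClosed_preimage]
    have : (Projectivization.mk' ℝ : {v : Fin 3 → ℝ // v ≠ 0} → Proj 2) ⁻¹' Z =
        {v | MvPolynomial.eval v.1 Q = 0} := by
      ext v
      rw [Set.mem_preimage, Projectivization.mk'_eq_mk, hmk]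
      rfl
    rw [this]
    exact isClosed_eq ((MvPolynomial.continuous_eval Q).comp continuous_subtype_val)
      continuous_const
  refine ⟨hcl, fun x₁ x₂ x₃ h₁ h₂ h₃ n12 n13 n23 => ?_⟩
  have : CompactSpace Z := isCompact_iff_compactSpace.mp hcl.isCompact
  rw [connectedComponentIn_eq_image h₁, connectedComponentIn_eq_image h₂] at n12
  rw [connectedComponentIn_eq_image h₁, connectedComponentIn_eq_image h₃] at n13
  rw [connectedComponentIn_eq_image h₂, connectedComponentIn_eq_image h₃] at n23
  rw [connectedComponentIn_eq_image h₁, connectedComponentIn_eq_image h₂,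
    connectedComponentIn_eq_image h₃]
  have sep : ∀ x y : Z, ((↑) '' connectedComponent x : Set (Proj 2)) ≠ (↑) '' connectedComponent y →
      ∃ U : Set Z, IsClopen U ∧ x ∈ U ∧ y ∉ U := by
    intro x y hxy
    have hy : y ∉ connectedComponent x := by
      intro h
      apply hxy
      rw [connectedComponent_eq h]
    rw [connectedComponent_eq_iInter_isClopen, Set.mem_iInter] at hy
    push Not at hy
    obtain ⟨⟨U, hU, hxU⟩, hyU⟩ := hy
    exact ⟨U, hU, hxU, hyU⟩
  obtain ⟨U, hU, U1, U2⟩ := sep _ _ n12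
  obtain ⟨U', hU', U1', U3'⟩ := sep _ _ n13
  obtain ⟨U'', hU'', U2'', U3''⟩ := sep _ _ n23
  have w1 : IsClopen (U ∩ U') := hU.inter hU'
  have w2 : IsClopen (U'' \ (U ∩ U')) := hU''.diff w1
  have w3 : IsClopen (U ∩ U' ∪ U'')ᶜ := (w1.union hU'').compl
  have clos : ∀ W : Set Z, IsClopen W → IsClosed ((↑) '' W : Set (Proj 2)) := fun W hW =>
    hcl.isClosedEmbedding_subtypeVal.isClosedMap _ hW.isClosed
  have hroot : ∀ W : Set Z, ∀ v ∈ qbCone ((↑) '' W : Set (Proj 2)), MvPolynomial.eval v Q = 0 := by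
    rintro W v ⟨hv, z, -, hz⟩
    rw [← hmk v hv, ← hz]
    exact z.2
  have hdisj : ∀ W W' : Set Z, Disjoint W W' → ∀ v ∈ qbCone ((↑) '' W : Set (Proj 2)),
      v ∉ qbCone ((↑) '' W' : Set (Proj 2)) := by
    rintro W W' hd v ⟨hv, z, hzW, hz⟩ ⟨hv', z', hzW', hz'⟩
    have : z = z' := Subtype.ext (hz.trans hz'.symm)
    subst this
    exact Set.disjoint_left.mp hd hzW hzW'
  refine ⟨(↑) '' (U ∩ U'), (↑) '' (U'' \ (U ∩ U')), (↑) '' (U ∩ U' ∪ U'')ᶜ, ?_, ?_, ?_, ?_⟩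
  · exact Set.image_mono (w1.connectedComponent_subset ⟨U1, U1'⟩)
  · exact Set.image_mono (w2.connectedComponent_subset ⟨U2'', fun h => U2 h.1⟩)
  · refine Set.image_mono (w3.connectedComponent_subset ?_)
    rintro (h | h)
    · exact U3' h.2
    · exact U3'' h
  · exact
    { cl1 := qbCone_closed (clos _ w1)
      cl2 := qbCone_closed (clos _ w2)
      cl3 := qbCone_closed (clos _ w3)
      sc1 := fun t ht v hv => qbCone_smul t ht v hv
      sc2 := fun t ht v hv => qbCone_smul t ht v hv
      sc3 := fun t ht v hv => qbCone_smul t ht v hv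
      nz1 := fun v hv => hv.1
      nz2 := fun v hv => hv.1
      nz3 := fun v hv => hv.1
      rt1 := hroot _
      rt2 := hroot _
      rt3 := hroot _
      d12 := hdisj _ _ Set.disjoint_sdiff_right
      d13 := hdisj _ _ (disjoint_compl_right.mono_left Set.subset_union_left)
      d23 := hdisj _ _ (disjoint_compl_right.mono_left
        (Set.diff_subset.trans Set.subset_union_right))
      cov := by
        intro v hv hq
        have hz := (hmk v hv).mpr hq
        by_cases hA : (⟨_, hz⟩ : Z) ∈ U ∩ U'
        · exact Or.inl ⟨hv, ⟨_, hz⟩, hA, rfl⟩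
        by_cases hB : (⟨_, hz⟩ : Z) ∈ U''
        · exact Or.inr (Or.inl ⟨hv, ⟨_, hz⟩, ⟨hB, hA⟩, rfl⟩)
        · exact Or.inr (Or.inr ⟨hv, ⟨_, hz⟩, fun h => h.elim hA hB, rfl⟩) }

theorem qb_tangent {A B : Type} [TopologicalSpace A] [TopologicalSpace B] [CompactSpace A]
    [CompactSpace B] [Nonempty A] [Nonempty B] (X Y : A → ℝ) (X' Y' : B → ℝ)
    (hX : Continuous X) (hY : Continuous Y) (hX' : Continuous X') (hY' : Continuous Y')
    (hlt : ∀ a b, X a < X' b) :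
    ∃ m c : ℝ, (∀ a, Y a - m * X a ≤ c) ∧ (∃ a, Y a - m * X a = c) ∧
      (∀ b, Y' b - m * X' b ≤ c) ∧ (∃ b, Y' b - m * X' b = c) := by
  have sup : ∀ {A : Type} [TopologicalSpace A] [CompactSpace A] [Nonempty A] (X Y : A → ℝ),
      Continuous X → Continuous Y → ∃ φ : ℝ → ℝ, Continuous φ ∧
        ∀ m, (∀ a, Y a - m * X a ≤ φ m) ∧ ∃ a, Y a - m * X a = φ m := by
    intro A _ _ _ X Y hX hY
    have hc : Continuous fun z : ℝ × A => Y z.2 - z.1 * X z.2 := by fun_prop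
    refine ⟨fun m => sSup ((fun a => Y a - m * X a) '' Set.univ),
      isCompact_univ.continuous_sSup hc, fun m => ?_⟩
    obtain ⟨a₀, -, ha₀⟩ := isCompact_univ.exists_isMaxOn (Set.univ_nonempty (α := A))
      (f := fun a => Y a - m * X a) (by fun_prop)
    have hg : IsGreatest ((fun a => Y a - m * X a) '' Set.univ) (Y a₀ - m * X a₀) :=
      ⟨⟨a₀, trivial, rfl⟩, by rintro _ ⟨a, ha, rfl⟩; exact ha₀ ha⟩
    simp only [hg.csSup_eq]
    exact ⟨fun a => ha₀ (Set.mem_univ a), a₀, rfl⟩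
  obtain ⟨φ, hφ, hφ'⟩ := sup X Y hX hY
  obtain ⟨ψ, hψ, hψ'⟩ := sup X' Y' hX' hY'
  have bdA : ∃ a₁, ∀ a, X a ≤ X a₁ := by
    obtain ⟨a, -, ha⟩ := isCompact_univ.exists_isMaxOn (Set.univ_nonempty (α := A)) hX.continuousOn
    exact ⟨a, fun x => ha (Set.mem_univ x)⟩
  have bdB : ∃ b₁, ∀ b, X' b₁ ≤ X' b := by
    obtain ⟨a, -, ha⟩ := isCompact_univ.exists_isMinOn (Set.univ_nonempty (α := B)) hX'.continuousOn
    exact ⟨a, fun x => ha (Set.mem_univ x)⟩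
  obtain ⟨a₁, ha₁⟩ := bdA
  obtain ⟨b₁, hb₁⟩ := bdB
  obtain ⟨η, hη⟩ : ∃ η, η = X' b₁ - X a₁ := ⟨_, rfl⟩
  have hη0 : 0 < η := by rw [hη]; linarith [hlt a₁ b₁]
  -- upper bounds for the two `Y`-coordinates are the values at slope zero
  have up : ∃ m, 0 ≤ φ m - ψ m := by
    obtain ⟨m, hm⟩ : ∃ m, m = |ψ 0 - Y a₁| / η := ⟨_, rfl⟩
    have hm0 : 0 ≤ m := by rw [hm]; positivity
    have hmη : m * η = |ψ 0 - Y a₁| := by rw [hm]; field_simp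
    refine ⟨m, ?_⟩
    obtain ⟨b, hb⟩ := (hψ' m).2
    have h1 := (hφ' m).1 a₁
    have h2 := (hψ' 0).1 b
    have h3 : m * X' b₁ ≤ m * X' b := mul_le_mul_of_nonneg_left (hb₁ b) hm0
    have h4 := le_abs_self (ψ 0 - Y a₁)
    rw [← hmη, hη] at h4
    nlinarith
  have dn : ∃ m, φ m - ψ m ≤ 0 := by
    obtain ⟨m, hm⟩ : ∃ m, m = |φ 0 - Y' b₁| / η := ⟨_, rfl⟩
    have hm0 : 0 ≤ m := by rw [hm]; positivity
    have hmη : m * η = |φ 0 - Y' b₁| := by rw [hm]; field_simp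
    refine ⟨-m, ?_⟩
    obtain ⟨a, ha⟩ := (hφ' (-m)).2
    have h1 := (hψ' (-m)).1 b₁
    have h2 := (hφ' 0).1 a
    have h3 : m * X a ≤ m * X a₁ := mul_le_mul_of_nonneg_left (ha₁ a) hm0
    have h4 := le_abs_self (φ 0 - Y' b₁)
    rw [← hmη, hη] at h4
    nlinarith
  obtain ⟨m, hm⟩ := mem_range_of_exists_le_of_exists_ge (hφ.sub hψ) dn up
  have hm' : ψ m = φ m := by
    have : φ m - ψ m = 0 := hm
    linarith
  refine ⟨m, φ m, (hφ' m).1, (hφ' m).2, ?_, ?_⟩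
  · intro b; rw [← hm']; exact (hψ' m).1 b
  · rw [← hm']; exact (hψ' m).2

theorem qb_sign (Ω : Set (Proj 2)) (hΩ : IsPreconnected Ω) (f g : (Fin 3 → ℝ) →L[ℝ] ℝ)
    (h0 : ∀ v ∈ qbCone Ω, f v * g v ≠ 0) :
    (∀ v ∈ qbCone Ω, 0 < f v * g v) ∨ (∀ v ∈ qbCone Ω, f v * g v < 0) := by
  have hmk : ∀ v (hv : v ≠ 0), ∃ c : ℝ, 0 < c ∧
      f (Projectivization.mk ℝ v hv).rep * g (Projectivization.mk ℝ v hv).rep = c * (f v * g v) := by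
    intro v hv
    obtain ⟨a, ha, h⟩ := qb_rep v hv
    refine ⟨a * a, mul_self_pos.mpr ha, ?_⟩
    rw [h, map_smul, map_smul, smul_eq_mul, smul_eq_mul]; ring
  have hpos : ∀ v (hv : v ≠ 0), 0 < f (Projectivization.mk ℝ v hv).rep *
      g (Projectivization.mk ℝ v hv).rep ↔ 0 < f v * g v := by
    intro v hv
    obtain ⟨c, hc, h⟩ := hmk v hv
    rw [h, mul_pos_iff_of_pos_left hc]
  have hneg : ∀ v (hv : v ≠ 0), f (Projectivization.mk ℝ v hv).rep *
      g (Projectivization.mk ℝ v hv).rep < 0 ↔ f v * g v < 0 := by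
    intro v hv
    obtain ⟨c, hc, h⟩ := hmk v hv
    rw [h]
    refine ⟨fun h1 => ?_, fun h1 => mul_neg_of_pos_of_neg hc h1⟩
    by_contra hh
    have := mul_nonneg hc.le (not_lt.mp hh)
    linarith
  have hcont : Continuous fun v : {v : Fin 3 → ℝ // v ≠ 0} => f v.1 * g v.1 :=
    (f.continuous.comp continuous_subtype_val).mul (g.continuous.comp continuous_subtype_val)
  have o1 : IsOpen {x : Proj 2 | 0 < f x.rep * g x.rep} := by
    rw [← qb_quot.isOpen_preimage]
    have : (Projectivization.mk' ℝ : {v : Fin 3 → ℝ // v ≠ 0} → Proj 2) ⁻¹'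
        {x : Proj 2 | 0 < f x.rep * g x.rep} = {v | 0 < f v.1 * g v.1} := by
      ext v; exact hpos v.1 v.2
    rw [this]
    exact isOpen_lt continuous_const hcont
  have o2 : IsOpen {x : Proj 2 | f x.rep * g x.rep < 0} := by
    rw [← qb_quot.isOpen_preimage]
    have : (Projectivization.mk' ℝ : {v : Fin 3 → ℝ // v ≠ 0} → Proj 2) ⁻¹'
        {x : Proj 2 | f x.rep * g x.rep < 0} = {v | f v.1 * g v.1 < 0} := by
      ext v; exact hneg v.1 v.2
    rw [this]
    exact isOpen_lt hcont continuous_const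
  have hd : Disjoint {x : Proj 2 | 0 < f x.rep * g x.rep} {x : Proj 2 | f x.rep * g x.rep < 0} := by
    rw [Set.disjoint_left]
    intro x hx hx'
    exact lt_asymm (show (0:ℝ) < f x.rep * g x.rep from hx)
      (show f x.rep * g x.rep < 0 from hx')
  have hsub : Ω ⊆ {x : Proj 2 | 0 < f x.rep * g x.rep} ∪ {x : Proj 2 | f x.rep * g x.rep < 0} := by
    intro x hx
    rcases lt_or_gt_of_ne (h0 x.rep (qbCone_rep.mpr hx)) with h | h
    · exact Or.inr h
    · exact Or.inl h
  rcases hΩ.subset_or_subset o1 o2 hd hsub with h | h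
  · exact Or.inl fun v hv => (hpos v hv.1).mp (h hv.2)
  · exact Or.inr fun v hv => (hneg v hv.1).mp (h hv.2)

/-- The unit vectors over a set. -/
def qbSph (Ω : Set (Proj 2)) : Set (Fin 3 → ℝ) := Metric.sphere 0 1 ∩ insert 0 (qbCone Ω)

theorem qbSph_compact {Ω : Set (Proj 2)} (h : IsClosed Ω) : IsCompact (qbSph Ω) :=
  (isCompact_sphere _ _).inter_right (qbCone_closed h)

theorem qbSph_cone {Ω : Set (Proj 2)} {v : Fin 3 → ℝ} (h : v ∈ qbSph Ω) : v ∈ qbCone Ω := by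
  refine h.2.resolve_left ?_
  rintro rfl
  have := h.1
  simp at this

theorem qbSph_of_cone {Ω : Set (Proj 2)} {v : Fin 3 → ℝ} (h : v ∈ qbCone Ω) :
    ∃ (t : ℝ) (w : Fin 3 → ℝ), t ≠ 0 ∧ w ∈ qbSph Ω ∧ v = t • w := by
  have h0 : ‖v‖ ≠ 0 := norm_ne_zero_iff.mpr h.1
  refine ⟨‖v‖, ‖v‖⁻¹ • v, h0, ⟨?_, Or.inr (qbCone_smul _ (inv_ne_zero h0) _ h)⟩, ?_⟩
  · simp [norm_smul, h0]
  · rw [smul_smul, mul_inv_cancel₀ h0, one_smul]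

theorem qb_supports (Ω : Set (Proj 2)) (f g : (Fin 3 → ℝ) →L[ℝ] ℝ)
    (hg : ∀ v ∈ qbCone Ω, g v ≠ 0) (hle : ∀ v ∈ qbSph Ω, f v / g v ≤ 0)
    (heq : ∃ v ∈ qbSph Ω, f v / g v = 0) : ∃ z, SupportsAt f Ω z := by
  obtain ⟨v, hv, hv0⟩ := heq
  obtain ⟨hne, hvΩ⟩ := qbSph_cone hv
  have hgv := hg v ⟨hne, hvΩ⟩
  have hfv : f v = 0 := by
    rcases div_eq_zero_iff.mp hv0 with h | h
    · exact h
    · exact absurd h hgv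
  obtain ⟨a, ha, hrep⟩ := qb_rep v hne
  refine ⟨Projectivization.mk ℝ v hne, hvΩ, ?_, g, ?_, ?_, Or.inr ?_⟩
  · rw [hrep, map_smul, hfv, smul_zero]
  · rw [hrep, map_smul]; exact smul_ne_zero ha hgv
  · intro y hy; exact hg _ (qbCone_rep.mpr hy)
  · intro y hy
    obtain ⟨t, w, ht, hw, h⟩ := qbSph_of_cone (qbCone_rep.mpr hy)
    have hgw := hg w (qbSph_cone hw)
    have h1 := hle w hw
    have : f y.rep * g y.rep = (f w / g w) * (t * g w) ^ 2 := by
      rw [h, map_smul, map_smul, smul_eq_mul, smul_eq_mul]; field_simp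
    rw [this]
    exact mul_nonpos_of_nonpos_of_nonneg h1 (sq_nonneg _)

theorem qb_bitangent_lt (Ω₁ Ω₂ : Set (Proj 2)) (cl₁ : IsClosed Ω₁) (cl₂ : IsClosed Ω₂)
    (ne₁ : Ω₁.Nonempty) (ne₂ : Ω₂.Nonempty) (p : Fin 3 → ℝ) (g k h : (Fin 3 → ℝ) →L[ℝ] ℝ)
    (hgp : g p = 0) (hkp : k p = 0) (hhp : h p ≠ 0)
    (hg₁ : ∀ v ∈ qbCone Ω₁, g v ≠ 0) (hg₂ : ∀ v ∈ qbCone Ω₂, g v ≠ 0)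
    (hlt : ∀ v ∈ qbCone Ω₁, ∀ w ∈ qbCone Ω₂, k v / g v < k w / g w) :
    ∃ f : (Fin 3 → ℝ) →L[ℝ] ℝ, f ≠ 0 ∧
      ∃ z₁ z₂, SupportsAt f Ω₁ z₁ ∧ SupportsAt f Ω₂ z₂ := by
  have : CompactSpace (qbSph Ω₁) := isCompact_iff_compactSpace.mp (qbSph_compact cl₁)
  have : CompactSpace (qbSph Ω₂) := isCompact_iff_compactSpace.mp (qbSph_compact cl₂)
  have nes : ∀ Ω : Set (Proj 2), Ω.Nonempty → Nonempty (qbSph Ω) := by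
    rintro Ω ⟨x, hx⟩
    obtain ⟨t, w, -, hw, -⟩ := qbSph_of_cone (qbCone_rep.mpr hx)
    exact ⟨⟨w, hw⟩⟩
  have := nes _ ne₁
  have := nes _ ne₂
  have hc : ∀ (Ω : Set (Proj 2)) (f : (Fin 3 → ℝ) →L[ℝ] ℝ), (∀ v ∈ qbCone Ω, g v ≠ 0) →
      Continuous fun v : qbSph Ω => f v.1 / g v.1 := fun Ω f hg =>
    (f.continuous.comp continuous_subtype_val).div (g.continuous.comp continuous_subtype_val)
      fun v => hg _ (qbSph_cone v.2)
  obtain ⟨m, c, A1, ⟨a, A2⟩, B1, ⟨b, B2⟩⟩ := qb_tangent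
    (fun v : qbSph Ω₁ => k v.1 / g v.1) (fun v => h v.1 / g v.1)
    (fun v : qbSph Ω₂ => k v.1 / g v.1) (fun v => h v.1 / g v.1)
    (hc _ k hg₁) (hc _ h hg₁) (hc _ k hg₂) (hc _ h hg₂)
    (fun v w => hlt _ (qbSph_cone v.2) _ (qbSph_cone w.2))
  have hf : ∀ v, g v ≠ 0 → (h - m • k - c • g) v / g v = h v / g v - m * (k v / g v) - c := by
    intro v hv
    simp only [ContinuousLinearMap.sub_apply, ContinuousLinearMap.smul_apply, smul_eq_mul]
    field_simp
  refine ⟨h - m • k - c • g, ?_, ?_⟩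
  · intro h0
    have := congrArg (fun l => l p) h0
    simp [hgp, hkp, hhp] at this
  · obtain ⟨z₁, hz₁⟩ := qb_supports Ω₁ (h - m • k - c • g) g hg₁ (by
      intro v hv
      rw [hf v (hg₁ _ (qbSph_cone hv))]
      linarith [A1 ⟨v, hv⟩]) ⟨a.1, a.2, by rw [hf _ (hg₁ _ (qbSph_cone a.2))]; linarith⟩
    obtain ⟨z₂, hz₂⟩ := qb_supports Ω₂ (h - m • k - c • g) g hg₂ (by
      intro v hv
      rw [hf v (hg₂ _ (qbSph_cone hv))]
      linarith [B1 ⟨v, hv⟩]) ⟨b.1, b.2, by rw [hf _ (hg₂ _ (qbSph_cone b.2))]; linarith⟩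
    exact ⟨z₁, z₂, hz₁, hz₂⟩

theorem qb_bitangent (Ω₁ Ω₂ : Set (Proj 2)) (cl₁ : IsClosed Ω₁) (cl₂ : IsClosed Ω₂)
    (ne₁ : Ω₁.Nonempty) (ne₂ : Ω₂.Nonempty) (pc₁ : IsPreconnected Ω₁) (pc₂ : IsPreconnected Ω₂)
    (p : Fin 3 → ℝ) (hp : p ≠ 0)
    (hno : ∀ f : (Fin 3 → ℝ) →L[ℝ] ℝ, f ≠ 0 → f p = 0 → ∀ v ∈ qbCone Ω₁, ∀ w ∈ qbCone Ω₂,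
      f v = 0 → f w = 0 → False) :
    ∃ f : (Fin 3 → ℝ) →L[ℝ] ℝ, f ≠ 0 ∧
      ∃ z₁ z₂, SupportsAt f Ω₁ z₁ ∧ SupportsAt f Ω₂ z₂ := by
  -- linear forms adapted to `p`
  obtain ⟨k1, k2, h, hk1, hk2, hh, hind⟩ : ∃ k1 k2 h : (Fin 3 → ℝ) →L[ℝ] ℝ, k1 p = 0 ∧ k2 p = 0 ∧
      h p ≠ 0 ∧ ∀ s t : ℝ, s • k1 + t • k2 = 0 → s = 0 ∧ t = 0 := by
    obtain ⟨i, hi⟩ : ∃ i, p i ≠ 0 := by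
      by_contra! h
      exact hp (funext h)
    have n1 : i + 1 ≠ i := by fin_cases i <;> decide
    have n2 : i + 2 ≠ i := by fin_cases i <;> decide
    have n3 : i + 1 ≠ i + 2 := by fin_cases i <;> decide
    let e : Fin 3 → (Fin 3 → ℝ) →L[ℝ] ℝ := fun j => ContinuousLinearMap.proj j
    refine ⟨p i • e (i + 1) - p (i + 1) • e i, p i • e (i + 2) - p (i + 2) • e i, e i, ?_, ?_, hi, ?_⟩
    · simp [e]; ring
    · simp [e]; ring
    · intro s t hst
      have h1 := congrArg (fun l => l (Pi.single (i + 1) 1)) hst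
      have h2 := congrArg (fun l => l (Pi.single (i + 2) 1)) hst
      simp [e, Pi.single_apply, n1, n2, n3, n1.symm, n2.symm, n3.symm, hi] at h1 h2
      exact ⟨h1, h2⟩
  let G : ℝ → (Fin 3 → ℝ) →L[ℝ] ℝ := fun θ => Real.cos θ • k1 + Real.sin θ • k2
  have hG0 : ∀ θ, G θ ≠ 0 := by
    intro θ h0
    have h1 := hind _ _ h0
    have h2 := Real.sin_sq_add_cos_sq θ
    rw [h1.1, h1.2] at h2
    norm_num at h2
  have hGp : ∀ θ, G θ p = 0 := by intro θ; simp [G, hk1, hk2]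
  have hGv : ∀ θ v, G θ v = Real.cos θ * k1 v + Real.sin θ * k2 v := by intro θ v; simp [G]
  have hGcl : ∀ Ω : Set (Proj 2), IsClosed Ω → IsClosed {θ | ∃ v ∈ qbSph Ω, G θ v = 0} := by
    intro Ω hΩ
    have : CompactSpace (qbSph Ω) := isCompact_iff_compactSpace.mp (qbSph_compact hΩ)
    have hc : IsClosed {z : ℝ × qbSph Ω | G z.1 z.2.1 = 0} := by
      simp only [hGv]
      refine isClosed_eq ?_ continuous_const
      have c1 : Continuous fun z : ℝ × qbSph Ω => k1 z.2.1 :=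
        k1.continuous.comp (continuous_subtype_val.comp continuous_snd)
      have c2 : Continuous fun z : ℝ × qbSph Ω => k2 z.2.1 :=
        k2.continuous.comp (continuous_subtype_val.comp continuous_snd)
      exact ((Real.continuous_cos.comp continuous_fst).mul c1).add
        ((Real.continuous_sin.comp continuous_fst).mul c2)
    have := isClosedMap_fst_of_compactSpace (X := ℝ) (Y := qbSph Ω) _ hc
    convert this using 1
    ext θ
    constructor
    · rintro ⟨v, hv, h⟩
      exact ⟨(θ, ⟨v, hv⟩), h, rfl⟩
    · rintro ⟨⟨θ', v⟩, h, rfl⟩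
      exact ⟨v.1, v.2, h⟩
  have hGne : ∀ Ω : Set (Proj 2), Ω.Nonempty → {θ | ∃ v ∈ qbSph Ω, G θ v = 0}.Nonempty := by
    rintro Ω ⟨x, hx⟩
    obtain ⟨t, w, -, hw, -⟩ := qbSph_of_cone (qbCone_rep.mpr hx)
    have hc : Continuous fun θ => G θ w := by simp only [hGv]; fun_prop
    have hneg : G Real.pi w = - G 0 w := by simp [hGv]
    have : ∃ θ, G θ w = 0 := by
      rcases le_total (G 0 w) 0 with h | h
      · exact mem_range_of_exists_le_of_exists_ge hc ⟨0, h⟩ ⟨Real.pi, by rw [hneg]; linarith⟩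
      · exact mem_range_of_exists_le_of_exists_ge hc ⟨Real.pi, by rw [hneg]; linarith⟩ ⟨0, h⟩
    obtain ⟨θ, hθ⟩ := this
    exact ⟨θ, w, hw, hθ⟩
  obtain ⟨θ, hθ₁, hθ₂⟩ : ∃ θ, (¬ ∃ v ∈ qbSph Ω₁, G θ v = 0) ∧ (¬ ∃ v ∈ qbSph Ω₂, G θ v = 0) := by
    by_contra! hcon
    have := isPreconnected_closed_iff.mp (isPreconnected_univ (α := ℝ)) _ _ (hGcl Ω₁ cl₁)
      (hGcl Ω₂ cl₂) (by
        intro θ _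
        by_cases h : ∃ v ∈ qbSph Ω₁, G θ v = 0
        · exact Or.inl h
        · exact Or.inr (hcon θ (by push Not at h; exact h)))
      (by simpa using hGne Ω₁ ne₁) (by simpa using hGne Ω₂ ne₂)
    obtain ⟨θ, -, ⟨v, hv, hv0⟩, ⟨w, hw, hw0⟩⟩ := this
    exact hno (G θ) (hG0 θ) (hGp θ) v (qbSph_cone hv) w (qbSph_cone hw) hv0 hw0
  let k : (Fin 3 → ℝ) →L[ℝ] ℝ := (-Real.sin θ) • k1 + Real.cos θ • k2
  have hkp : k p = 0 := by simp [k, hk1, hk2]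
  have hconv : ∀ Ω : Set (Proj 2), (¬ ∃ v ∈ qbSph Ω, G θ v = 0) → ∀ v ∈ qbCone Ω, G θ v ≠ 0 := by
    intro Ω hΩ v hv h0
    obtain ⟨t, w, ht, hw, rfl⟩ := qbSph_of_cone hv
    rw [map_smul] at h0
    exact hΩ ⟨w, hw, (smul_eq_zero.mp h0).resolve_left ht⟩
  have hg₁ := hconv _ hθ₁
  have hg₂ := hconv _ hθ₂
  have hkt : ∀ t : ℝ, k - t • G θ ≠ 0 := by
    intro t h0
    have : (-Real.sin θ - t * Real.cos θ) • k1 + (Real.cos θ - t * Real.sin θ) • k2 = 0 := by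
      rw [← h0]; simp only [k, G]; module
    have h1 := hind _ _ this
    have h2 := Real.sin_sq_add_cos_sq θ
    have h3 : (1 : ℝ) = 0 := by
      linear_combination (-Real.sin θ) * h1.1 + Real.cos θ * h1.2 - h2
    norm_num at h3
  have hktp : ∀ t : ℝ, (k - t • G θ) p = 0 := by intro t; simp [hkp, hGp]
  have hval : ∀ (t : ℝ) v, G θ v ≠ 0 →
      (k - t • G θ) v * G θ v = (k v / G θ v - t) * (G θ v) ^ 2 := by
    intro t v hv
    simp only [ContinuousLinearMap.sub_apply, ContinuousLinearMap.smul_apply, smul_eq_mul]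
    field_simp
  have hzero : ∀ (t : ℝ) v, G θ v ≠ 0 → k v / G θ v = t → (k - t • G θ) v = 0 := by
    intro t v hv h
    rw [← h]
    simp only [ContinuousLinearMap.sub_apply, ContinuousLinearMap.smul_apply, smul_eq_mul]
    field_simp
    ring
  have hXne : ∀ v ∈ qbCone Ω₁, ∀ w ∈ qbCone Ω₂, k v / G θ v ≠ k w / G θ w := by
    intro v hv w hw h
    exact hno _ (hkt (k w / G θ w)) (hktp _) v hv w hw (hzero _ v (hg₁ v hv) h)
      (hzero _ w (hg₂ w hw) rfl)
  have side : ∀ Ω : Set (Proj 2), IsPreconnected Ω → (∀ v ∈ qbCone Ω, G θ v ≠ 0) → ∀ t : ℝ,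
      (∀ v ∈ qbCone Ω, k v / G θ v ≠ t) →
      (∀ v ∈ qbCone Ω, t < k v / G θ v) ∨ (∀ v ∈ qbCone Ω, k v / G θ v < t) := by
    intro Ω hΩ hg t ht
    have := qb_sign Ω hΩ (k - t • G θ) (G θ) (by
      intro v hv
      rw [hval t v (hg v hv)]
      exact mul_ne_zero (sub_ne_zero.mpr (ht v hv)) (pow_ne_zero _ (hg v hv)))
    refine this.imp (fun H v hv => ?_) (fun H v hv => ?_)
    · have h1 := H v hv
      rw [hval t v (hg v hv)] at h1
      have := (mul_pos_iff_of_pos_right (sq_pos_of_ne_zero (hg v hv))).mp h1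
      linarith
    · have h1 := H v hv
      rw [hval t v (hg v hv)] at h1
      by_contra hh
      have := mul_nonneg (sub_nonneg.mpr (not_lt.mp hh)) (sq_nonneg (G θ v))
      linarith
  obtain ⟨x, hx⟩ := ne₁
  obtain ⟨y, hy⟩ := ne₂
  have hx' := qbCone_rep.mpr hx
  have hy' := qbCone_rep.mpr hy
  rcases side Ω₁ pc₁ hg₁ (k y.rep / G θ y.rep) (fun v hv => hXne v hv _ hy') with h1 | h1
  · refine qb_bitangent_lt Ω₁ Ω₂ cl₁ cl₂ ⟨x, hx⟩ ⟨y, hy⟩ p (G θ) (-k) h (hGp θ) (by simp [hkp]) hh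
      hg₁ hg₂ ?_
    intro v hv w hw
    simp only [ContinuousLinearMap.neg_apply, neg_div]
    rcases side Ω₂ pc₂ hg₂ (k v / G θ v) (fun w hw => (hXne v hv w hw).symm) with h2 | h2
    · linarith [h2 _ hy', h1 v hv]
    · linarith [h2 w hw]
  · refine qb_bitangent_lt Ω₁ Ω₂ cl₁ cl₂ ⟨x, hx⟩ ⟨y, hy⟩ p (G θ) k h (hGp θ) hkp hh hg₁ hg₂ ?_
    intro v hv w hw
    rcases side Ω₂ pc₂ hg₂ (k v / G θ v) (fun w hw => (hXne v hv w hw).symm) with h2 | h2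
    · exact h2 w hw
    · linarith [h2 _ hy', h1 v hv]

/-- For a smooth real plane quartic whose real locus has at least three connected components,
given two components `Ω₁, Ω₂` and a point `p` on a third component: no line through `p` meets
both `Ω₁` and `Ω₂`, and consequently there is a line supporting both `Ω₁` and `Ω₂` (a
bitangent of the quartic). -/
theorem quartic_bitangent (Q : MvPolynomial (Fin 3) ℝ) (hQ : Q.IsHomogeneous 4)
    (hsm : ∀ v : Fin 3 → ℂ, v ≠ 0 →
      MvPolynomial.eval v (MvPolynomial.map (algebraMap ℝ ℂ) Q) = 0 →
      ∃ i, MvPolynomial.eval v (MvPolynomial.pderiv i (MvPolynomial.map (algebraMap ℝ ℂ) Q)) ≠ 0)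
    (Z : Set (Proj 2)) (hZ : Z = {x : Proj 2 | MvPolynomial.eval x.rep Q = 0})
    (x₁ x₂ x₃ : Proj 2) (hx₁ : x₁ ∈ Z) (hx₂ : x₂ ∈ Z) (hx₃ : x₃ ∈ Z)
    (Ω₁ Ω₂ Ω₃ : Set (Proj 2))
    (hΩ₁ : Ω₁ = connectedComponentIn Z x₁) (hΩ₂ : Ω₂ = connectedComponentIn Z x₂)
    (hΩ₃ : Ω₃ = connectedComponentIn Z x₃)
    (h12 : Ω₁ ≠ Ω₂) (h13 : Ω₁ ≠ Ω₃) (h23 : Ω₂ ≠ Ω₃)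
    (p : Proj 2) (hpΩ : p ∈ Ω₃) :
    (¬ ∃ f : (Fin 3 → ℝ) →L[ℝ] ℝ, f ≠ 0 ∧ f p.rep = 0 ∧
      (∃ x ∈ Ω₁, f x.rep = 0) ∧ (∃ x ∈ Ω₂, f x.rep = 0)) ∧
    ∃ f : (Fin 3 → ℝ) →L[ℝ] ℝ, f ≠ 0 ∧
      ∃ z₁ z₂, SupportsAt f Ω₁ z₁ ∧ SupportsAt f Ω₂ z₂ := by
  obtain ⟨hZcl, hpart⟩ := qb_partition Q hQ Z hZ
  subst hΩ₁ hΩ₂ hΩ₃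
  obtain ⟨W₁, W₂, W₃, s₁, s₂, s₃, H⟩ := hpart x₁ x₂ x₃ hx₁ hx₂ hx₃ h12 h13 h23
  have hno : ¬ ∃ f : (Fin 3 → ℝ) →L[ℝ] ℝ, f ≠ 0 ∧ f p.rep = 0 ∧
      (∃ x ∈ connectedComponentIn Z x₁, f x.rep = 0) ∧
      (∃ x ∈ connectedComponentIn Z x₂, f x.rep = 0) := by
    rintro ⟨f, hf0, hfp, ⟨x, hx, hfx⟩, ⟨y, hy, hfy⟩⟩
    have ha : x.rep ∈ qbCone W₁ := qbCone_rep.mpr (s₁ hx)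
    have hb : y.rep ∈ qbCone W₂ := qbCone_rep.mpr (s₂ hy)
    have hp : p.rep ∈ qbCone W₃ := qbCone_rep.mpr (s₃ hpΩ)
    have hli : LinearIndependent ℝ ![x.rep, y.rep] := by
      rw [LinearIndependent.pair_iff' (H.nz1 _ ha)]
      intro t ht
      have ht0 : t ≠ 0 := by
        rintro rfl
        exact H.nz2 _ hb (by rw [← ht, zero_smul])
      exact H.d12 _ (ht ▸ H.sc1 t ht0 _ ha) hb
    have hmem : p.rep ∈ Submodule.span ℝ (Set.range ![x.rep, y.rep]) := by
      by_contra hw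
      have hli3 : LinearIndependent ℝ ![p.rep, x.rep, y.rep] :=
        linearIndependent_finCons.mpr ⟨hli, hw⟩
      have hspan : Submodule.span ℝ (Set.range ![p.rep, x.rep, y.rep]) = ⊤ := by
        apply hli3.span_eq_top_of_card_eq_finrank'
        simp
      apply hf0
      have : (f : (Fin 3 → ℝ) →ₗ[ℝ] ℝ) = 0 := by
        apply LinearMap.ext_on_range hspan
        intro i
        fin_cases i
        · simpa using hfp
        · simpa using hfx
        · simpa using hfy
      ext1 v
      exact congrArg (fun l => l v) this
    simp only [Matrix.range_cons, Matrix.range_empty, Set.union_empty, Set.singleton_union] at hmem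
    obtain ⟨α, β, hαβ⟩ := Submodule.mem_span_pair.mp hmem
    have hα : α ≠ 0 := by
      rintro rfl
      rw [zero_smul, zero_add] at hαβ
      have hβ : β ≠ 0 := by
        rintro rfl
        exact H.nz3 _ hp (by rw [← hαβ, zero_smul])
      exact H.d23 _ (hαβ ▸ H.sc2 β hβ _ hb) hp
    have hβ : β ≠ 0 := by
      rintro rfl
      rw [zero_smul, add_zero] at hαβ
      exact H.d13 _ (hαβ ▸ H.sc1 α hα _ ha) hp
    exact qb_collinear Q hQ hsm _ _ _ H (α • x.rep) (β • y.rep) (H.sc1 α hα _ ha)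
      (H.sc2 β hβ _ hb) (by rw [hαβ]; exact hp)
  refine ⟨hno, ?_⟩
  have hcc : ∀ x ∈ Z, IsClosed (connectedComponentIn Z x) := by
    intro x hx
    rw [connectedComponentIn_eq_image hx]
    exact hZcl.isClosedEmbedding_subtypeVal.isClosedMap _ isClosed_connectedComponent
  refine qb_bitangent _ _ (hcc _ hx₁) (hcc _ hx₂) ⟨x₁, mem_connectedComponentIn hx₁⟩
    ⟨x₂, mem_connectedComponentIn hx₂⟩ isPreconnected_connectedComponentIn
    isPreconnected_connectedComponentIn p.rep p.rep_nonzero ?_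
  intro f hf hfp v hv w hw hfv hfw
  obtain ⟨a, -, hra⟩ := qb_rep v hv.1
  obtain ⟨b, -, hrb⟩ := qb_rep w hw.1
  exact hno ⟨f, hf, hfp, ⟨_, hv.2, by rw [hra, map_smul, hfv, smul_zero]⟩,
    ⟨_, hw.2, by rw [hrb, map_smul, hfw, smul_zero]⟩⟩
end

section
/- Under the hypotheses of the main theorem (closed connected sets A₁,…,A_n in ℙ^n(ℝ) and a point p through which no hyperplane meets all Aᵢ), if in addition each Aᵢ contains a non-empty open subset of ℙ^n(ℝ), then there exist at least n + 1 distinct hyperplanes each of which is an n-supporting hyperplane of A₁, …, A_n. -/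
/-- If a compact set spans, so do its extreme points. -/
lemma aux_extreme_span {E : Type*} [NormedAddCommGroup E] [NormedSpace ℝ E]
    [FiniteDimensional ℝ E] {S : Set E} (hS : IsCompact S) (hspan : Submodule.span ℝ S = ⊤) :
    Submodule.span ℝ (S.extremePoints ℝ) = ⊤ := by
  have key : ∀ φ : E →L[ℝ] ℝ, (∀ x ∈ S.extremePoints ℝ, φ x = 0) → ∀ s ∈ S, φ s ≤ 0 := by
    intro φ hφ s hs
    obtain ⟨m, hm, hmax⟩ := hS.exists_isMaxOn ⟨s, hs⟩ φ.continuous.continuousOn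
    let F : Set E := {x ∈ S | ∀ y ∈ S, φ y ≤ φ x}
    have hF : IsExposed ℝ S F := fun _ => ⟨φ, rfl⟩
    have hmF : m ∈ F := ⟨hm, fun y hy => hmax hy⟩
    obtain ⟨x, hx⟩ := (hF.isCompact hS).extremePoints_nonempty ⟨m, hmF⟩
    have h1 := hφ x (hF.isExtreme.extremePoints_subset_extremePoints hx)
    have h2 := hx.1.2 s hs
    linarith
  by_contra hne
  obtain ⟨φ, hφ0, hφ⟩ := Submodule.exists_le_ker_of_lt_top _ (lt_top_iff_ne_top.2 hne)
  let ψ : E →L[ℝ] ℝ := LinearMap.toContinuousLinearMap φ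
  have hψ : ∀ x ∈ S.extremePoints ℝ, ψ x = 0 := fun x hx => hφ (Submodule.subset_span hx)
  have hz : S ⊆ LinearMap.ker φ := fun s hs => by
    have h1 := key ψ hψ s hs
    have h2 := key (-ψ) (fun x hx => by simp [hψ x hx]) s hs
    have h3 : ψ s = 0 := le_antisymm h1 (by simpa using h2)
    exact h3
  apply hφ0
  rw [← LinearMap.ker_eq_top, eq_top_iff, ← hspan]
  exact Submodule.span_le.2 hz

lemma aux_form {n : ℕ} (w : Fin n → (Fin (n + 1) → ℝ)) :
    ∃ f : (Fin (n + 1) → ℝ) →L[ℝ] ℝ, f ≠ 0 ∧ ∀ i, f (w i) = 0 := by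
  let T : Module.Dual ℝ (Fin (n + 1) → ℝ) →ₗ[ℝ] (Fin n → ℝ) :=
    LinearMap.pi (fun i => Module.Dual.eval ℝ _ (w i))
  have hk : LinearMap.ker T ≠ ⊥ := by
    apply LinearMap.ker_ne_bot_of_finrank_lt
    rw [Subspace.dual_finrank_eq]
    simp
  obtain ⟨f, hf, hf0⟩ := Submodule.exists_mem_ne_zero_of_ne_bot hk
  refine ⟨LinearMap.toContinuousLinearMap f, by simpa using hf0, fun i => ?_⟩
  have := congrFun (LinearMap.mem_ker.1 hf) i
  simpa [T] using this

lemma aux_rep {n : ℕ} (v : Fin (n + 1) → ℝ) (hv : v ≠ 0) :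
    ∃ a : ℝ, a ≠ 0 ∧ (Projectivization.mk ℝ v hv).rep = a • v := by
  obtain ⟨a, ha⟩ := Projectivization.exists_smul_eq_mk_rep ℝ v hv
  exact ⟨a, a.ne_zero, ha.symm⟩

lemma aux_rep_zero {n : ℕ} (f : (Fin (n + 1) → ℝ) →L[ℝ] ℝ) (v : Fin (n + 1) → ℝ) (hv : v ≠ 0) :
    f (Projectivization.mk ℝ v hv).rep = 0 ↔ f v = 0 := by
  obtain ⟨a, ha, h⟩ := aux_rep v hv
  simp [h, ha]

lemma aux_quot {n : ℕ} : Topology.IsQuotientMap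
    (fun v : {v : Fin (n + 1) → ℝ // v ≠ 0} => (Projectivization.mk ℝ v.1 v.2 : Proj n)) :=
  isQuotientMap_quotient_mk'

lemma aux_cont {n : ℕ} (f g : (Fin (n + 1) → ℝ) →L[ℝ] ℝ) :
    ContinuousOn (fun x : Proj n => f x.rep / g x.rep) {x | g x.rep ≠ 0} := by
  have hpre : (fun v : {v : Fin (n + 1) → ℝ // v ≠ 0} =>
      (Projectivization.mk ℝ v.1 v.2 : Proj n)) ⁻¹' {x | g x.rep ≠ 0} = {v | g v.1 ≠ 0} := by
    ext v
    simp [aux_rep_zero]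
  have ho : IsOpen {x : Proj n | g x.rep ≠ 0} := by
    rw [← aux_quot.isOpen_preimage, hpre]
    exact isOpen_ne_fun (by fun_prop) continuous_const
  rw [aux_quot.continuousOn_isOpen_iff ho, hpre]
  have : ContinuousOn (fun v : {v : Fin (n + 1) → ℝ // v ≠ 0} => f v.1 / g v.1)
      {v | g v.1 ≠ 0} :=
    ContinuousOn.div (by fun_prop) (by fun_prop) (fun v hv => hv)
  refine this.congr fun v hv => ?_
  obtain ⟨a, ha, h⟩ := aux_rep v.1 v.2
  simp only [Function.comp, h, map_smul, smul_eq_mul]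
  exact mul_div_mul_left _ _ ha

/-- forms meeting a closed set form a closed set -/
lemma aux_closed {n : ℕ} (A : Set (Proj n)) (hA : IsClosed A) :
    IsClosed {f : (Fin (n + 1) → ℝ) →L[ℝ] ℝ | ∃ x ∈ A, f x.rep = 0} := by
  let S := Metric.sphere (0 : Fin (n + 1) → ℝ) 1
  have hS : ∀ v : S, v.1 ≠ 0 := fun v => ne_zero_of_mem_unit_sphere v
  let q : S → Proj n := fun v => Projectivization.mk ℝ v.1 (hS v)
  have hq : Continuous q :=
    aux_quot.continuous.comp (Continuous.subtype_mk continuous_subtype_val hS)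
  let C : Set (((Fin (n + 1) → ℝ) →L[ℝ] ℝ) × S) := {z | q z.2 ∈ A ∧ z.1 z.2.1 = 0}
  have hC : IsClosed C := by
    apply IsClosed.inter
    · exact hA.preimage (hq.comp continuous_snd)
    · exact isClosed_eq (by fun_prop) continuous_const
  have := isClosedMap_fst_of_compactSpace C hC
  convert this using 1
  ext f
  simp only [Set.mem_ofPred_eq, Set.mem_image, Prod.exists, C]
  constructor
  · rintro ⟨x, hx, h⟩
    have hn : ‖x.rep‖ ≠ 0 := norm_ne_zero_iff.2 x.rep_nonzero
    let v : S := ⟨‖x.rep‖⁻¹ • x.rep, by simp [S, norm_smul, hn]⟩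
    refine ⟨f, v, ⟨?_, by simp [v, h]⟩, rfl⟩
    have : q v = x := by
      conv_rhs => rw [← x.mk_rep]
      rw [Projectivization.mk_eq_mk_iff']
      exact ⟨‖x.rep‖⁻¹, rfl⟩
    rwa [this]
  · rintro ⟨f', v, ⟨h1, h2⟩, rfl⟩
    exact ⟨q v, h1, (aux_rep_zero _ _ _).2 h2⟩

/-- The dual set. -/
def dualSet {n : ℕ} (A : Fin n → Set (Proj n)) (p : Proj n) :
    Set ((Fin (n + 1) → ℝ) →L[ℝ] ℝ) :=
  {f | f p.rep = 1 ∧ ∀ i, ∃ x ∈ A i, f x.rep = 0}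

lemma aux_compact {n : ℕ} (A : Fin n → Set (Proj n))
    (hcl : ∀ i, IsClosed (A i)) (p : Proj n)
    (hp : ¬ ∃ f : (Fin (n + 1) → ℝ) →L[ℝ] ℝ, f ≠ 0 ∧ f p.rep = 0 ∧
      ∀ i, ∃ x ∈ A i, f x.rep = 0) : IsCompact (dualSet A p) := by
  let C : Set ((Fin (n + 1) → ℝ) →L[ℝ] ℝ) :=
    Metric.sphere 0 1 ∩ ⋂ i, {f | ∃ x ∈ A i, f x.rep = 0}
  have hC : IsCompact C :=
    (isCompact_sphere _ _).inter_right (isClosed_iInter fun i => aux_closed _ (hcl i))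
  have hne : ∀ f ∈ C, f p.rep ≠ 0 := by
    intro f hf h
    refine hp ⟨f, ?_, h, fun i => Set.mem_iInter.1 hf.2 i⟩
    exact ne_zero_of_mem_unit_sphere (⟨f, hf.1⟩ : Metric.sphere (0 : (Fin (n + 1) → ℝ) →L[ℝ] ℝ) 1)
  have himg : dualSet A p = (fun f : (Fin (n + 1) → ℝ) →L[ℝ] ℝ => (f p.rep)⁻¹ • f) '' C := by
    ext f
    constructor
    · rintro ⟨h1, h2⟩
      have hf : ‖f‖ ≠ 0 := by
        rw [norm_ne_zero_iff]; rintro rfl; simp at h1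
      refine ⟨‖f‖⁻¹ • f, ⟨by simp [norm_smul, hf], Set.mem_iInter.2 fun i => ?_⟩, ?_⟩
      · obtain ⟨x, hx, h⟩ := h2 i
        exact ⟨x, hx, by simp [h]⟩
      · simp [h1, smul_smul, hf]
    · rintro ⟨g, hg, rfl⟩
      refine ⟨by simp [hne g hg], fun i => ?_⟩
      obtain ⟨x, hx, h⟩ := Set.mem_iInter.1 hg.2 i
      exact ⟨x, hx, by simp [h]⟩
  rw [himg]
  apply hC.image_of_continuousOn
  have hinv : ContinuousOn (fun f : (Fin (n + 1) → ℝ) →L[ℝ] ℝ => (f p.rep)⁻¹) C :=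
    ContinuousOn.inv₀ (by fun_prop) hne
  exact hinv.smul continuousOn_id

lemma aux_span {n : ℕ} (A : Fin n → Set (Proj n))
    (hop : ∀ i, ∃ U : Set (Proj n), IsOpen U ∧ U.Nonempty ∧ U ⊆ A i) (p : Proj n)
    (hp : ¬ ∃ f : (Fin (n + 1) → ℝ) →L[ℝ] ℝ, f ≠ 0 ∧ f p.rep = 0 ∧
      ∀ i, ∃ x ∈ A i, f x.rep = 0) : Submodule.span ℝ (dualSet A p) = ⊤ := by
  choose U hU hUne hUA using hop
  choose y hy using hUne
  obtain ⟨f, hf0, hf⟩ := aux_form (fun i => (y i).rep)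
  have hfp : f p.rep ≠ 0 := fun h => hp ⟨f, hf0, h, fun i => ⟨y i, hUA i (hy i), hf i⟩⟩
  set F := (f p.rep)⁻¹ • f with hF
  have hFp : F p.rep = 1 := by simp [hF, hfp]
  have hFy : ∀ i, F (y i).rep = 0 := fun i => by simp [hF, hf i]
  have hFm : F ∈ dualSet A p := ⟨hFp, fun i => ⟨y i, hUA i (hy i), hFy i⟩⟩
  have key : ∀ i, ∃ h : (Fin (n + 1) → ℝ) →L[ℝ] ℝ, h ∈ Submodule.span ℝ (dualSet A p) ∧
      h p.rep = 0 ∧ (∀ j, j ≠ i → h (y j).rep = 0) ∧ h (y i).rep ≠ 0 := by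
    intro i
    obtain ⟨h, h0, hh⟩ := aux_form (Function.update (fun i => (y i).rep) i p.rep)
    have hhp : h p.rep = 0 := by simpa using hh i
    have hhj : ∀ j, j ≠ i → h (y j).rep = 0 := fun j hj => by simpa [hj] using hh j
    have hhi : h (y i).rep ≠ 0 := by
      intro h'
      refine hp ⟨h, h0, hhp, fun j => ⟨y j, hUA j (hy j), ?_⟩⟩
      by_cases hj : j = i
      · rwa [hj]
      · exact hhj j hj
    refine ⟨h, ?_, hhp, hhj, hhi⟩
    have hne : ∀ t : ℝ, (y i).rep + t • p.rep ≠ 0 := by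
      intro t ht
      apply hhi
      have := congrArg h ht
      simpa [hhp] using this
    let c : ℝ → Proj n := fun t => Projectivization.mk ℝ _ (hne t)
    have hc : Continuous c := aux_quot.continuous.comp
      (Continuous.subtype_mk (f := fun t : ℝ => (y i).rep + t • p.rep) (by fun_prop) hne)
    have hc0 : c 0 = y i := by
      conv_rhs => rw [← (y i).mk_rep]
      simp [c]
    have hnear : ∀ᶠ t in nhds (0 : ℝ), c t ∈ U i :=
      hc.continuousAt.eventually_mem ((hU i).mem_nhds (by rw [hc0]; exact hy i))
    have hnear' : ∀ᶠ t in nhdsWithin (0 : ℝ) {0}ᶜ, c t ∈ U i := hnear.filter_mono nhdsWithin_le_nhds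
    obtain ⟨t, ht, ht0⟩ := (hnear'.and self_mem_nhdsWithin).exists
    have ht0 : t ≠ 0 := ht0
    set s := - t / h (y i).rep with hs
    have hs0 : s ≠ 0 := div_ne_zero (neg_ne_zero.2 ht0) hhi
    have hm : F + s • h ∈ dualSet A p := by
      refine ⟨by simp [hFp, hhp], fun j => ?_⟩
      by_cases hj : j = i
      · subst hj
        refine ⟨c t, hUA _ ht, (aux_rep_zero _ _ _).2 ?_⟩
        simp [hFp, hhp, hFy, hs, hhi]
      · exact ⟨y j, hUA j (hy j), by simp [hFy, hhj j hj]⟩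
    have h2 : h = s⁻¹ • ((F + s • h) - F) := by simp [smul_smul, hs0]
    rw [h2]
    exact Submodule.smul_mem _ _ (Submodule.sub_mem _ (Submodule.subset_span hm)
      (Submodule.subset_span hFm))
  choose h hhm hhp hhj hhi using key
  rw [eq_top_iff]
  let B : Fin (n + 1) → ((Fin (n + 1) → ℝ) →L[ℝ] ℝ) := Fin.cons F h
  have hB : LinearIndependent ℝ B := by
    rw [Fintype.linearIndependent_iff]
    intro a ha
    have ha' : a 0 • F + ∑ i : Fin n, a i.succ • h i = 0 := by
      simpa [Fin.sum_univ_succ, B] using ha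
    have e1 : a 0 = 0 := by
      have := congrArg (fun g : (Fin (n + 1) → ℝ) →L[ℝ] ℝ => g p.rep) ha'
      simpa [_root_.sum_apply, hFp, hhp] using this
    intro k
    refine Fin.cases e1 (fun j => ?_) k
    have := congrArg (fun g : (Fin (n + 1) → ℝ) →L[ℝ] ℝ => g (y j).rep) ha'
    simp only [_root_.add_apply, _root_.sum_apply,
      _root_.smul_apply, hFy, _root_.zero_apply, smul_eq_mul] at this
    rw [Finset.sum_eq_single j (fun i _ hij => by rw [hhj i j hij.symm, mul_zero]) (by simp)] at this
    simpa [hhi j] using this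
  have hfr : Module.finrank ℝ ((Fin (n + 1) → ℝ) →L[ℝ] ℝ) = n + 1 := by
    rw [← (LinearMap.toContinuousLinearMap (𝕜 := ℝ) (E := Fin (n + 1) → ℝ)
      (F' := ℝ)).finrank_eq]
    exact (Subspace.dual_finrank_eq).trans (by simp)
  rw [← hB.span_eq_top_of_card_eq_finrank (by simp [hfr]), Submodule.span_le]
  rintro _ ⟨k, rfl⟩
  refine Fin.cases ?_ (fun j => ?_) k
  · exact Submodule.subset_span hFm
  · exact hhm j

lemma aux_support {n : ℕ} (A : Fin n → Set (Proj n))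
    (hconn : ∀ i, IsConnected (A i)) (p : Proj n)
    (hp : ¬ ∃ f : (Fin (n + 1) → ℝ) →L[ℝ] ℝ, f ≠ 0 ∧ f p.rep = 0 ∧
      ∀ i, ∃ x ∈ A i, f x.rep = 0) (f : (Fin (n + 1) → ℝ) →L[ℝ] ℝ)
    (hf : f ∈ (dualSet A p).extremePoints ℝ) :
    ∃ x : Fin n → Proj n, ∀ i, SupportsAt f (A i) (x i) := by
  have hfm : f ∈ dualSet A p := hf.1
  obtain ⟨hfp, hfA⟩ := hfm
  choose x hxA hx0 using hfA
  refine ⟨x, fun i => ⟨hxA i, hx0 i, ?_⟩⟩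
  obtain ⟨h, h0, hh⟩ := aux_form (Function.update (fun i => (x i).rep) i p.rep)
  have hhp : h p.rep = 0 := by simpa using hh i
  have hhj : ∀ j, j ≠ i → h (x j).rep = 0 := fun j hj => by simpa [hj] using hh j
  have hhi : ∀ y ∈ A i, h y.rep ≠ 0 := by
    intro y hy h'
    refine hp ⟨h, h0, hhp, fun j => ?_⟩
    by_cases hj : j = i
    · subst hj; exact ⟨y, hy, h'⟩
    · exact ⟨x j, hxA j, hhj j hj⟩
  refine ⟨h, hhi _ (hxA i), hhi, ?_⟩
  by_contra! hcon
  obtain ⟨⟨y, hy, hy'⟩, ⟨z, hz, hz'⟩⟩ := hcon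
  let r : Proj n → ℝ := fun x => f x.rep / h x.rep
  have hr : (r '' A i).OrdConnected :=
    ((hconn i).isPreconnected.image r ((aux_cont f h).mono hhi)).ordConnected
  have hry : r y < 0 := div_neg_iff.2 (mul_neg_iff.1 hy')
  have hrz : 0 < r z := div_pos_iff.2 (mul_pos_iff.1 hz')
  set e := min (-r y) (r z) with he
  have he0 : 0 < e := lt_min (by linarith) hrz
  have he1 : e ≤ -r y := min_le_left _ _
  have he2 : e ≤ r z := min_le_right _ _
  have hmem : ∀ s : ℝ, |s| ≤ e → f + s • h ∈ dualSet A p := by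
    intro s hs
    rw [abs_le] at hs
    refine ⟨by simp [hfp, hhp], fun j => ?_⟩
    by_cases hj : j = i
    · subst hj
      obtain ⟨w, hw, hws⟩ := hr.out ⟨y, hy, rfl⟩ ⟨z, hz, rfl⟩
        (show -s ∈ Set.Icc (r y) (r z) from ⟨by linarith, by linarith⟩)
      refine ⟨w, hw, ?_⟩
      have : f w.rep = -s * h w.rep := (div_eq_iff (hhi w hw)).1 hws
      simp [this]
    · exact ⟨x j, hxA j, by simp [hx0, hhj j hj]⟩
  have h1 := hmem e (by rw [abs_of_pos he0])
  have h2 := hmem (-e) (by rw [abs_neg, abs_of_pos he0])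
  have h3 := hf.2 h1 h2 ⟨1/2, 1/2, by norm_num, by norm_num, by norm_num, by module⟩
  simp [he0.ne', h0] at h3

theorem exists_many_supporting_hyperplanes (n : ℕ) (A : Fin n → Set (Proj n))
    (hcl : ∀ i, IsClosed (A i)) (hconn : ∀ i, IsConnected (A i))
    (hop : ∀ i, ∃ U : Set (Proj n), IsOpen U ∧ U.Nonempty ∧ U ⊆ A i) (p : Proj n)
    (hp : ¬ ∃ f : (Fin (n + 1) → ℝ) →L[ℝ] ℝ, f ≠ 0 ∧ f p.rep = 0 ∧
      ∀ i, ∃ x ∈ A i, f x.rep = 0) :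
    ∃ Λ : Fin (n + 1) → (Fin (n + 1) → ℝ) →L[ℝ] ℝ, (∀ k, Λ k ≠ 0) ∧
      Function.Injective (fun k => {x : Proj n | (Λ k) x.rep = 0}) ∧
      ∀ k, ∃ x : Fin n → Proj n, ∀ i, SupportsAt (Λ k) (A i) (x i) := by
  set E := (dualSet A p).extremePoints ℝ with hE
  have hspan : Submodule.span ℝ E = ⊤ :=
    aux_extreme_span (aux_compact A hcl p hp) (aux_span A hop p hp)
  have hfr : Module.finrank ℝ ((Fin (n + 1) → ℝ) →L[ℝ] ℝ) = n + 1 := by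
    rw [← (LinearMap.toContinuousLinearMap (𝕜 := ℝ) (E := Fin (n + 1) → ℝ)
      (F' := ℝ)).finrank_eq]
    exact (Subspace.dual_finrank_eq).trans (by simp)
  obtain ⟨b, hbE, hbs, hbl⟩ := exists_linearIndependent ℝ E
  let B := Module.Basis.mk hbl (by simp [hbs, hspan])
  let e := (Module.finBasisOfFinrankEq ℝ _ hfr).indexEquiv B
  have hL : ∀ k, (e k : (Fin (n + 1) → ℝ) →L[ℝ] ℝ) ∈ E := fun k => hbE (e k).2
  have hLp : ∀ k, (e k : (Fin (n + 1) → ℝ) →L[ℝ] ℝ) p.rep = 1 := fun k =>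
    (hL k).1.1
  refine ⟨fun k => (e k).1, fun k hk => ?_, fun k l hkl => ?_, fun k =>
    aux_support A hconn p hp _ (hL k)⟩
  · have := hLp k
    have hk' : (e k).1 = 0 := hk
    rw [hk'] at this
    simp at this
  · apply e.injective
    apply Subtype.ext
    ext1 v
    set u := v - (e k).1 v • p.rep with hu
    have hku : (e k).1 u = 0 := by simp [hu, hLp]
    have hlu : (e l).1 u = 0 := by
      by_cases hu0 : u = 0
      · simp [hu0]
      · have hm : (Projectivization.mk ℝ u hu0 : Proj n) ∈
            {x : Proj n | (e k).1 x.rep = 0} := (aux_rep_zero _ _ _).2 hku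
        have hkl' : {x : Proj n | (e k).1 x.rep = 0} = {x : Proj n | (e l).1 x.rep = 0} := hkl
        rw [hkl'] at hm
        exact (aux_rep_zero _ _ _).1 hm
    simp only [hu, map_sub, map_smul, hLp, smul_eq_mul, mul_one] at hlu
    linarith
end
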